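/- arXiv:1406.1702 — 7 statements merged into one kernel-verified Lean document; each statement's English description precedes it below -/
import Mathlib

section
/- Let G be a group acting on a finite set Ω (every element of G having finite order). Assume that every g ∈ G whose order is square-free has a regular cycle on Ω. Then every g ∈ G has a regular cycle on Ω. -/
open MulAction

/-- A point lies in a regular cycle of an element `g` of finite order if and only if no nontrivial
power of `g` fixes it. -/
theorem ncard_orbit_zpowers_eq_orderOf_iff {G Ω : Type*} [Group G] [MulAction G Ω]
    {g : G} (hg : IsOfFinOrder g) (ω : Ω) :
    (orbit (Subgroup.zpowers g) ω).ncard = orderOf g ↔ ∀ k : ℕ, g ^ k • ω = ω → g ^ k = 1 := by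
  have : Finite (Subgroup.zpowers g) := hg.finite_zpowers
  have hmul := Subgroup.card_mul_index (stabilizer (Subgroup.zpowers g) ω)
  rw [index_stabilizer, Nat.card_zpowers] at hmul
  have hpos : 0 < orderOf g := hg.orderOf_pos
  have hcard : (orbit (Subgroup.zpowers g) ω).ncard = orderOf g ↔
      Nat.card (stabilizer (Subgroup.zpowers g) ω) = 1 := by
    constructor
    · intro h
      rw [h] at hmul
      exact Nat.eq_of_mul_eq_mul_right hpos (by rw [hmul, one_mul])
    · intro h
      rwa [h, one_mul] at hmul
  rw [hcard, Subgroup.card_eq_one, Subgroup.eq_bot_iff_forall]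
  constructor
  · intro h k hk
    exact congrArg Subtype.val (h ⟨g ^ k, Subgroup.npow_mem_zpowers g k⟩ hk)
  · rintro h ⟨x, hx⟩ hxω
    obtain ⟨k, rfl⟩ := (hg.mem_powers_iff_mem_zpowers).2 hx
    exact Subtype.ext (h k hxω)

/-- **Lemma 2.1** (reduction to square-free order). Let `G` act on a finite set `Ω`, with every
element of `G` of finite order. If every element of `G` of square-free order has a regular
cycle, then every element of `G` has a regular cycle. -/
theorem regular_cycle_of_squarefree_regular_cycle
    {G Ω : Type*} [Group G] [Fintype Ω] [MulAction G Ω]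
    (hfin : ∀ g : G, IsOfFinOrder g)
    (hsf : ∀ g : G, Squarefree (orderOf g) →
      ∃ ω : Ω, (MulAction.orbit (Subgroup.zpowers g) ω).ncard = orderOf g) :
    ∀ g : G, ∃ ω : Ω, (MulAction.orbit (Subgroup.zpowers g) ω).ncard = orderOf g := by
  intro g
  have hn : orderOf g ≠ 0 := (hfin g).orderOf_pos.ne'
  obtain ⟨m, hm⟩ := UniqueFactorizationMonoid.radical_dvd_self (a := orderOf g)
  have hm0 : m ≠ 0 := by
    rintro rfl
    exact hn (by simpa using hm)
  have hord : orderOf (g ^ m) = UniqueFactorizationMonoid.radical (orderOf g) := by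
    rw [orderOf_pow_of_dvd hm0 (Dvd.intro_left _ hm.symm)]
    exact Nat.div_eq_of_eq_mul_left (Nat.pos_of_ne_zero hm0) hm
  obtain ⟨ω, hω⟩ := hsf (g ^ m) (by
    rw [hord]
    exact UniqueFactorizationMonoid.squarefree_radical)
  refine ⟨ω, (ncard_orbit_zpowers_eq_orderOf_iff (hfin g) ω).2 fun k hk => ?_⟩
  rw [ncard_orbit_zpowers_eq_orderOf_iff (hfin _) ω] at hω
  by_contra hne
  obtain ⟨p, hp, hpk⟩ := Nat.exists_prime_and_dvd (mt orderOf_eq_one_iff.1 hne)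
  obtain ⟨t, ht⟩ := hpk
  have ht0 : t ≠ 0 := by
    rintro rfl
    exact (hfin (g ^ k)).orderOf_pos.ne' (by simpa using ht)
  have hpord : orderOf (g ^ (k * t)) = p := by
    rw [pow_mul, orderOf_pow_of_dvd ht0 (Dvd.intro_left _ ht.symm)]
    exact Nat.div_eq_of_eq_mul_left (Nat.pos_of_ne_zero ht0) ht
  have hpn : p ∣ orderOf g := hpord ▸ orderOf_pow_dvd (k * t)
  obtain ⟨s, hs⟩ : p ∣ UniqueFactorizationMonoid.radical (orderOf g) :=
    (UniqueFactorizationMonoid.dvd_radical_iff_of_irreducible hp hn).2 hpn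
  have hdvd : m ∣ k * t := by
    have h : orderOf g ∣ p * (k * t) := by
      rw [orderOf_dvd_iff_pow_eq_one, mul_comm, pow_mul, ← hpord, pow_orderOf_eq_one]
    rw [hm, hs, mul_assoc] at h
    exact (Dvd.intro_left s rfl).trans (Nat.dvd_of_mul_dvd_mul_left hp.pos h)
  obtain ⟨j, hj⟩ := hdvd
  have hfix : g ^ (k * t) • ω = ω := by
    rw [pow_mul]
    exact (stabilizer G ω).pow_mem hk t
  rw [hj, pow_mul] at hfix hpord
  rw [hω j hfix, orderOf_one] at hpord
  exact hp.one_lt.ne hpord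
end

section
/- Let G be a group acting on a finite nonempty set Ω, and let g ∈ G be an element of finite order with g ≠ 1. If the sum, over all primes r dividing the order |g| of g, of the fixed point ratios fpr_Ω(g^{|g|/r}) is strictly less than 1, then g has a regular cycle on Ω. -/
open MulAction

/-- If the fixed point ratios of finitely many elements sum to less than `1`, then some point is
fixed by none of these elements. -/
theorem exists_forall_notMem_fixedBy_of_sum_lt_one {G Ω ι : Type*} [Group G] [Fintype Ω]
    [Nonempty Ω] [MulAction G Ω] (s : Finset ι) (x : ι → G)
    (h : ∑ i ∈ s, ((MulAction.fixedBy Ω (x i)).ncard : ℝ) / (Fintype.card Ω) < 1) :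
    ∃ ω : Ω, ∀ i ∈ s, ω ∉ MulAction.fixedBy Ω (x i) := by
  by_contra! hcover
  have hunion : (⋃ i ∈ s, MulAction.fixedBy Ω (x i)) = Set.univ :=
    Set.eq_univ_of_forall fun ω => by simpa using hcover ω
  have hcard : Fintype.card Ω ≤ ∑ i ∈ s, (MulAction.fixedBy Ω (x i)).ncard := by
    rw [← Nat.card_eq_fintype_card, ← Set.ncard_univ, ← hunion]
    exact s.set_ncard_biUnion_le _
  have hpos : (0 : ℝ) < Fintype.card Ω := by exact_mod_cast Fintype.card_pos
  rw [← Finset.sum_div, div_lt_one hpos] at h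
  exact absurd h (not_lt.mpr (by exact_mod_cast hcard))

/-- A divisor `m` of `n ≠ 0` dividing no `n / r` with `r` a prime factor of `n` equals `n`. -/
theorem Nat.eq_of_dvd_of_forall_not_dvd_div_primeFactors {m n : ℕ} (hn : n ≠ 0) (hmn : m ∣ n)
    (h : ∀ r ∈ n.primeFactors, ¬ m ∣ n / r) : m = n := by
  obtain ⟨k, rfl⟩ := hmn
  by_contra hne
  obtain ⟨r, hr, l, rfl⟩ := Nat.exists_prime_and_dvd (n := k) (by rintro rfl; simp at hne)
  have hdvd : r ∣ m * (r * l) := ⟨m * l, by ring⟩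
  refine h r (Nat.mem_primeFactors.mpr ⟨hr, hdvd, hn⟩) ⟨l, ?_⟩
  exact Nat.div_eq_of_eq_mul_right hr.pos (by ring)

/-- **Lemma 2.4** (second part). Let `G` act on a finite nonempty set `Ω` and let `g ∈ G` be a
nontrivial element of finite order. If `∑_{r prime, r ∣ |g|} fpr_Ω(g^{|g|/r}) < 1`, then `g`
has a regular cycle. -/
theorem regular_cycle_of_sum_fpr_lt_one
    {G Ω : Type*} [Group G] [Fintype Ω] [Nonempty Ω] [MulAction G Ω]
    (g : G) (hg : IsOfFinOrder g) (hg1 : g ≠ 1)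
    (hsum : ∑ r ∈ (orderOf g).primeFactors,
        ((MulAction.fixedBy Ω (g ^ (orderOf g / r))).ncard : ℝ) / (Fintype.card Ω) < 1) :
    ∃ ω : Ω, (MulAction.orbit (Subgroup.zpowers g) ω).ncard = orderOf g := by
  obtain ⟨ω, hω⟩ := exists_forall_notMem_fixedBy_of_sum_lt_one _ _ hsum
  refine ⟨ω, ?_⟩
  have hfin : Fintype (orbit (Subgroup.zpowers g) ω) := Fintype.ofFinite _
  rw [← Nat.card_coe_set_eq, Nat.card_eq_fintype_card, ← minimalPeriod_eq_card]
  refine Nat.eq_of_dvd_of_forall_not_dvd_div_primeFactors hg.orderOf_pos.ne' ?_ fun r hr hdvd =>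
    hω r hr ?_
  · rw [← pow_smul_eq_iff_minimalPeriod_dvd, pow_orderOf_eq_one, one_smul]
  · rwa [mem_fixedBy, pow_smul_eq_iff_minimalPeriod_dvd]
end

section
/- For every integer n ≥ 26, the number ω(n) of distinct prime divisors of n satisfies ω(n) ≤ log(n) / (log(log(n)) − 1.1714), where log denotes the natural logarithm (note that log(log(n)) > 1.1714 for n ≥ 26). -/
/-- `force n f = f n`, arranged so that evaluation normalises `n` before entering `f`. -/
def force {α : Type} (n : ℕ) (f : ℕ → α) : α :=
  match n with
  | 0 => f 0
  | m + 1 => f (m + 1)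

theorem force_eq {α : Type} (n : ℕ) (f : ℕ → α) : force n f = f n := by
  cases n <;> rfl

/-- Fixed-point scan of the odd numbers following `m` that are coprime to `P`. With all logarithms
scaled by `10 ^ 12`, `q` is the last number kept, `k` counts the numbers kept so far, `a` is a lower
bound for `log q`, `A` a lower bound for the sum of the logarithms of the numbers kept, and `l` an
upper bound for `log A`. Every visited state is tested for `k * (log A - 1.1714) ≤ A`, and the
final state is compared with the given one. -/
def scan (P m' q' k' a' A' l' : ℕ) : ℕ → ℕ → ℕ → ℕ → ℕ → ℕ → ℕ → Bool
  | 0, m, q, k, a, A, l =>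
    m.beq m' && q.beq q' && k.beq k' && a.beq a' && A.beq A' && l.beq l'
  | n + 1, m, q, k, a, A, l =>
    force (m + 2) fun m ↦
    bif (m.gcd P).beq 1 then
      force (a + 2 * (m - q) * 1000000000000 / (m + q) +
        2 * (m - q) ^ 3 * 1000000000000 / (3 * (m + q) ^ 3)) fun a ↦
      force (2 * A + a) fun D ↦
      force (l + 2 * a * 1000000000000 / D + 2 * a ^ 3 * 1000000000000 / (3 * D ^ 3) +
        2 * a ^ 5 * 1000000000000 / (D ^ 3 * (D ^ 2 - a ^ 2)) + 3) fun l ↦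
      force (A + a) fun A ↦
      force (k + 1) fun k ↦
      Nat.ble (k * (10000 * l)) (10000 * A + 11714 * k * 1000000000000) &&
        (Nat.ble (k * 1000000000000) A &&
        scan P m' q' k' a' A' l' n m m k a A l)
    else scan P m' q' k' a' A' l' n m q k a A l

/-- The deficit `∑ (y - log p)` over the primes `p ≤ m`. -/
noncomputable def primeDeficit (m : ℕ) (y : ℝ) : ℝ :=
  ∑ p ∈ Finset.range (m + 1), if p.Prime then y - Real.log p else 0

/-- The meaning of a state of `scan`. -/
structure ScanInv (m q k a A l : ℕ) : Prop where
  odd : Odd m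
  three_le : 3 ≤ q
  le : q ≤ m
  one_le : 1 ≤ k
  pos : 0 < a
  log_q : (a : ℝ) ≤ 1000000000000 * Real.log q
  le_A : k * 1000000000000 ≤ A
  log_A : 1000000000000 * Real.log (A / 1000000000000) ≤ (l : ℝ)
  deficit : ∀ y : ℝ, Real.log q ≤ y → primeDeficit m y ≤ k * y - A / 1000000000000

/-- The bound asserted for all integers with `k` distinct prime factors. -/
def OmegaBound (k : ℕ) : Prop :=
  ∀ n : ℕ, n ≠ 0 → n.primeFactors.card = k →
    (k : ℝ) * (Real.log (Real.log n) - 1.1714) ≤ Real.log n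

theorem card_mul_sub_log_le_primeDeficit {n m : ℕ} (hn : n ≠ 0) {y : ℝ}
    (hy : Real.log m ≤ y) (hy' : y ≤ Real.log (m + 1)) :
    n.primeFactors.card * y - Real.log n ≤ primeDeficit m y := by
  have hlog : ∑ p ∈ n.primeFactors, Real.log p ≤ Real.log n := by
    rw [← Real.log_prod (fun p hp ↦ by
      exact_mod_cast (Nat.prime_of_mem_primeFactors hp).ne_zero), ← Nat.cast_prod]
    refine Real.log_le_log ?_ ?_
    · exact_mod_cast Finset.prod_pos fun p hp ↦ (Nat.prime_of_mem_primeFactors hp).pos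
    · exact_mod_cast Nat.le_of_dvd (Nat.pos_of_ne_zero hn) (Nat.prod_primeFactors_dvd n)
  have hsum : (n.primeFactors.card : ℝ) * y - ∑ p ∈ n.primeFactors, Real.log p
      = ∑ p ∈ n.primeFactors, (y - Real.log p) := by
    simp [Finset.sum_sub_distrib]
  have hle : ∑ p ∈ n.primeFactors, (y - Real.log p) ≤ primeDeficit m y := by
    calc ∑ p ∈ n.primeFactors, (y - Real.log p)
        ≤ ∑ p ∈ n.primeFactors, if p ≤ m then y - Real.log p else 0 := by
          refine Finset.sum_le_sum fun p hp ↦ ?_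
          split_ifs with h
          · exact le_rfl
          · have : Real.log (m + 1) ≤ Real.log p :=
              Real.log_le_log (by positivity) (by exact_mod_cast Nat.lt_of_not_le h)
            linarith
      _ = ∑ p ∈ n.primeFactors with p ≤ m, (y - Real.log p) := by rw [Finset.sum_filter]
      _ ≤ ∑ p ∈ Finset.range (m + 1) with p.Prime, (y - Real.log p) := by
          refine Finset.sum_le_sum_of_subset_of_nonneg (fun p hp ↦ ?_) (fun p hp _ ↦ ?_)
          · simp only [Finset.mem_filter, Nat.mem_primeFactors, Finset.mem_range] at hp ⊢
            exact ⟨by lia, hp.1.1⟩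
          · simp only [Finset.mem_filter, Finset.mem_range] at hp
            have : Real.log p ≤ Real.log m :=
              Real.log_le_log (by exact_mod_cast hp.2.pos)
                (by exact_mod_cast Nat.le_of_lt_succ hp.1)
            linarith
      _ = primeDeficit m y := by rw [primeDeficit, Finset.sum_filter]
  linarith

theorem primeDeficit_succ (m : ℕ) (y : ℝ) : primeDeficit (m + 1) y =
    primeDeficit m y + if (m + 1).Prime then y - Real.log ((m + 1 : ℕ) : ℝ) else 0 := by
  rw [primeDeficit, Finset.sum_range_succ, ← primeDeficit]

theorem primeDeficit_add_two_of_odd {m : ℕ} (hm : Odd m) (h3 : 3 ≤ m) (y : ℝ) :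
    primeDeficit (m + 2) y =
      primeDeficit m y + if (m + 2).Prime then y - Real.log ((m + 2 : ℕ) : ℝ) else 0 := by
  have : ¬ (m + 1).Prime := fun h ↦ by
    have h2 : 2 ∣ m + 1 := by obtain ⟨r, rfl⟩ := hm; exact ⟨r + 1, by ring⟩
    have := (Nat.prime_dvd_prime_iff_eq Nat.prime_two h).1 h2
    lia
  rw [primeDeficit_succ (m + 1), primeDeficit_succ m, if_neg this, add_zero]

theorem log_add_le_log {q w : ℝ} (hq : 0 < q) (hw : q ≤ w) :
    Real.log q + 2 * (w - q) / (w + q) + 2 * (w - q) ^ 3 / (3 * (w + q) ^ 3) ≤ Real.log w := by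
  have hs : 0 < w + q := by linarith
  have h := Real.sum_range_le_log_div (x := (w - q) / (w + q))
    (div_nonneg (by linarith) hs.le) (by rw [div_lt_one hs]; linarith) 2
  have e : (1 + (w - q) / (w + q)) / (1 - (w - q) / (w + q)) = w / q := by
    have : w + q - (w - q) ≠ 0 := by ring_nf; positivity
    field_simp
    ring
  rw [e, Real.log_div (by linarith) hq.ne'] at h
  simp only [Finset.sum_range_succ, Finset.sum_range_zero] at h
  norm_num [div_pow] at h
  have e2 : 2 * (w - q) ^ 3 / (3 * (w + q) ^ 3) = 2 * ((w - q) ^ 3 / (w + q) ^ 3 / 3) := by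
    field_simp
  rw [e2, mul_div_assoc]
  linarith

theorem log_add_le {A a : ℝ} (hA : 0 < A) (ha : 0 < a) :
    Real.log (A + a) ≤ Real.log A + 2 * a / (2 * A + a) + 2 * a ^ 3 / (3 * (2 * A + a) ^ 3) +
      2 * a ^ 5 / ((2 * A + a) ^ 3 * ((2 * A + a) ^ 2 - a ^ 2)) := by
  set D := 2 * A + a with hD
  have hs : 0 < D := by positivity
  have h := Real.log_div_le_sum_range_add (x := a / D)
    (by positivity) (by rw [div_lt_one hs]; linarith) 2
  have e : (1 + a / D) / (1 - a / D) = (A + a) / A := by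
    have h1 : 1 - a / D = 2 * A / D := by field_simp; rw [hD]; ring
    rw [h1]; field_simp; rw [hD]; ring
  rw [e, Real.log_div (by positivity) hA.ne'] at h
  simp only [Finset.sum_range_succ, Finset.sum_range_zero] at h
  norm_num [div_pow] at h
  have hDa : 0 < D ^ 2 - a ^ 2 := by
    have : D ^ 2 - a ^ 2 = 4 * A * (A + a) := by rw [hD]; ring
    rw [this]; positivity
  have e2 : 2 * a ^ 3 / (3 * D ^ 3) = 2 * (a ^ 3 / D ^ 3 / 3) := by
    field_simp
  have e3 : 2 * a ^ 5 / (D ^ 3 * (D ^ 2 - a ^ 2)) = 2 * (a ^ 5 / D ^ 5 / (1 - a ^ 2 / D ^ 2)) := by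
    have : 1 - a ^ 2 / D ^ 2 = (D ^ 2 - a ^ 2) / D ^ 2 := by field_simp
    rw [this]; field_simp
  rw [e2, e3, mul_div_assoc]
  linarith

theorem ScanInv.omegaBound {m q k a A l : ℕ} (h : ScanInv m q k a A l)
    (hk : k * (10000 * l) ≤ 10000 * A + 11714 * k * 1000000000000) : OmegaBound k := by
  intro n hn hcard
  have hm : Real.log q ≤ Real.log m :=
    Real.log_le_log (by exact_mod_cast (by have := h.three_le; lia)) (by exact_mod_cast h.le)
  have hd := h.deficit _ hm
  have hc := card_mul_sub_log_le_primeDeficit hn le_rfl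
    (Real.log_le_log (by have := h.three_le; have := h.le; exact_mod_cast (by lia))
      (by linarith) : Real.log (m : ℝ) ≤ Real.log (m + 1))
  rw [hcard] at hc
  have hk1 : (1 : ℝ) ≤ k := by exact_mod_cast h.one_le
  set T : ℝ := A / 1000000000000 with hT
  have hTL : T ≤ Real.log n := by linarith
  have hkT : (k : ℝ) ≤ T := by
    rw [hT, le_div_iff₀ (by norm_num)]; exact_mod_cast h.le_A
  have hkl : (k : ℝ) * (10000 * l) ≤ 10000 * A + 11714 * k * 1000000000000 := by
    exact_mod_cast hk
  have hlA := h.log_A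
  have hbound : (k : ℝ) * (Real.log T - 1.1714) ≤ T := by
    have : (k : ℝ) * (1000000000000 * Real.log T) ≤ k * l := by gcongr
    rw [hT] at this ⊢
    linarith
  have hT0 : 0 < T := by linarith
  have htan : Real.log (Real.log n) ≤ Real.log T + (Real.log n / T - 1) := by
    have := Real.log_le_sub_one_of_pos (x := Real.log n / T)
      (div_pos (by linarith) hT0)
    rw [Real.log_div (by linarith) hT0.ne'] at this
    linarith
  have h2 : (k : ℝ) * (Real.log n / T - 1) ≤ Real.log n - T := by
    have e : Real.log n / T - 1 = (Real.log n - T) / T := by field_simp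
    rw [e, ← mul_div_assoc, div_le_iff₀ hT0, mul_comm]
    exact mul_le_mul_of_nonneg_left hkT (by linarith)
  have h3 := mul_le_mul_of_nonneg_left htan (by linarith : (0 : ℝ) ≤ k)
  linarith

theorem natCast_div_le_real (x y : ℕ) : ((x / y : ℕ) : ℝ) ≤ x / y := Nat.cast_div_le

theorem real_div_le_natCast_add_one (x y : ℕ) : (x : ℝ) / y ≤ (x / y : ℕ) + 1 := by
  rw [← Nat.floor_div_eq_div (K := ℝ)]
  exact (Nat.lt_floor_add_one _).le

theorem ScanInv.skip {m q k a A l P : ℕ} (h : ScanInv m q k a A l)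
    (hP : ∀ p, p.Prime → m < p → p.gcd P = 1) (hg : (m + 2).gcd P ≠ 1) :
    ScanInv (m + 2) q k a A l where
  odd := by have := h.odd; grind
  three_le := h.three_le
  le := by have := h.le; lia
  one_le := h.one_le
  pos := h.pos
  log_q := h.log_q
  le_A := h.le_A
  log_A := h.log_A
  deficit y hy := by
    rw [primeDeficit_add_two_of_odd h.odd (h.three_le.trans h.le), if_neg, add_zero]
    · exact h.deficit y hy
    · exact fun hp ↦ hg (hP _ hp (by lia))

theorem ScanInv.keep {m q k a A l a' l' : ℕ} (h : ScanInv m q k a A l)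
    (ha' : a' = a + 2 * (m + 2 - q) * 1000000000000 / (m + 2 + q) +
        2 * (m + 2 - q) ^ 3 * 1000000000000 / (3 * (m + 2 + q) ^ 3))
    (hl' : l' = l + 2 * a' * 1000000000000 / (2 * A + a') +
        2 * a' ^ 3 * 1000000000000 / (3 * (2 * A + a') ^ 3) +
        2 * a' ^ 5 * 1000000000000 / ((2 * A + a') ^ 3 * ((2 * A + a') ^ 2 - a' ^ 2)) + 3)
    (hk : (k + 1) * 1000000000000 ≤ A + a') :
    ScanInv (m + 2) (m + 2) (k + 1) a' (A + a') l' := by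
  have hq3 := h.three_le
  have hqm := h.le
  have ha0 : 0 < a' := by have := h.pos; lia
  have hA0 : 0 < A := by have := h.le_A; have := h.one_le; lia
  have hloga : (a' : ℝ) ≤ 1000000000000 * Real.log ((m + 2 : ℕ) : ℝ) := by
    have hlog := log_add_le_log (q := q) (w := (m + 2 : ℕ)) (by exact_mod_cast (by lia))
      (by exact_mod_cast (by lia))
    have h1 := natCast_div_le_real (2 * (m + 2 - q) * 1000000000000) (m + 2 + q)
    have h2 := natCast_div_le_real (2 * (m + 2 - q) ^ 3 * 1000000000000) (3 * (m + 2 + q) ^ 3)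
    have h3 := h.log_q
    have hc : (a' : ℝ) = a + (2 * (m + 2 - q) * 1000000000000 / (m + 2 + q) : ℕ) +
        (2 * (m + 2 - q) ^ 3 * 1000000000000 / (3 * (m + 2 + q) ^ 3) : ℕ) := by
      rw [ha']; push_cast; ring
    have hsub : ((m + 2 - q : ℕ) : ℝ) = (m + 2 : ℕ) - q := Nat.cast_sub (by lia)
    rw [hc]
    rw [Nat.cast_mul, Nat.cast_mul, hsub, Nat.cast_add (m + 2) q] at h1
    rw [Nat.cast_mul, Nat.cast_mul, Nat.cast_pow, hsub, Nat.cast_mul, Nat.cast_pow,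
      Nat.cast_add (m + 2) q] at h2
    rw [mul_div_right_comm] at h1 h2
    push_cast at h1 h2 hlog ⊢
    linarith
  refine ⟨by have := h.odd; grind, by lia, le_rfl, by lia, ha0, hloga, hk, ?_, ?_⟩
  · have hlog := log_add_le (A := A) (a := a') (by exact_mod_cast hA0) (by exact_mod_cast ha0)
    have h1 := real_div_le_natCast_add_one (2 * a' * 1000000000000) (2 * A + a')
    have h2 := real_div_le_natCast_add_one (2 * a' ^ 3 * 1000000000000) (3 * (2 * A + a') ^ 3)
    have h3 := real_div_le_natCast_add_one (2 * a' ^ 5 * 1000000000000)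
      ((2 * A + a') ^ 3 * ((2 * A + a') ^ 2 - a' ^ 2))
    have h4 := h.log_A
    have hsub : (((2 * A + a') ^ 2 - a' ^ 2 : ℕ) : ℝ) = (2 * A + a') ^ 2 - a' ^ 2 := by
      rw [Nat.cast_sub (Nat.pow_le_pow_left (by lia) 2)]; push_cast; ring
    have hc : (l' : ℝ) = l + (2 * a' * 1000000000000 / (2 * A + a') : ℕ) +
        (2 * a' ^ 3 * 1000000000000 / (3 * (2 * A + a') ^ 3) : ℕ) +
        (2 * a' ^ 5 * 1000000000000 / ((2 * A + a') ^ 3 * ((2 * A + a') ^ 2 - a' ^ 2)) : ℕ)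
          + 3 := by
      rw [hl']; push_cast; ring
    rw [hc]
    rw [Nat.cast_mul, Nat.cast_mul] at h1
    rw [Nat.cast_mul _ 1000000000000] at h2
    rw [Nat.cast_mul _ 1000000000000, Nat.cast_mul ((2 * A + a') ^ 3), hsub] at h3
    rw [mul_div_right_comm] at h1 h2 h3
    rw [Real.log_div (by exact_mod_cast hA0.ne') (by norm_num)] at h4
    rw [Real.log_div (by exact_mod_cast (by lia)) (by norm_num)]
    push_cast at h1 h2 h3 hlog ⊢
    linarith
  · intro y hy
    have hqy : Real.log q ≤ y := le_trans (Real.log_le_log (by exact_mod_cast (by lia))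
      (by exact_mod_cast (by lia))) hy
    have hd := h.deficit y hqy
    rw [primeDeficit_add_two_of_odd h.odd (h.three_le.trans h.le)]
    have : (if (m + 2).Prime then y - Real.log ((m + 2 : ℕ) : ℝ) else 0) ≤
        y - Real.log ((m + 2 : ℕ) : ℝ) := by
      split_ifs
      · exact le_rfl
      · linarith
    push_cast at this hloga hd ⊢
    linarith

theorem ScanInv.of_scan {P m' q' k' a' A' l' : ℕ} (n : ℕ) {m q k a A l : ℕ}
    (h : ScanInv m q k a A l) (hP : ∀ p, p.Prime → m < p → p.gcd P = 1)
    (hs : scan P m' q' k' a' A' l' n m q k a A l = true) :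
    ScanInv m' q' k' a' A' l' ∧ ∀ j, k < j → j ≤ k' → OmegaBound j := by
  induction n generalizing m q k a A l with
  | zero =>
    simp only [scan, Bool.and_eq_true, Nat.beq_eq] at hs
    obtain ⟨⟨⟨⟨⟨rfl, rfl⟩, rfl⟩, rfl⟩, rfl⟩, rfl⟩ := hs
    exact ⟨h, fun j h1 h2 ↦ by lia⟩
  | succ n ih =>
    have hP' : ∀ p, p.Prime → m + 2 < p → p.gcd P = 1 := fun p hp hm ↦ hP p hp (by lia)
    simp only [scan, force_eq] at hs
    by_cases hg : (m + 2).gcd P = 1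
    · have hb : ((m + 2).gcd P).beq 1 = true := by rw [hg]; rfl
      rw [hb, cond_true] at hs
      simp only [Bool.and_eq_true, Nat.ble_eq] at hs
      obtain ⟨h1, h2, h3⟩ := hs
      have hinv := h.keep rfl rfl h2
      obtain ⟨h4, h5⟩ := ih hinv hP' h3
      refine ⟨h4, fun j hj hj' ↦ ?_⟩
      rcases Nat.lt_or_ge (k + 1) j with hlt | hge
      · exact h5 j hlt hj'
      · obtain rfl : j = k + 1 := by lia
        exact hinv.omegaBound h1
    · have hb : ((m + 2).gcd P).beq 1 = false := by
        rw [← Bool.not_eq_true, Nat.beq_eq]; exact hg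
      rw [hb, cond_false] at hs
      exact ih (h.skip hP hg) hP' hs

theorem log_23_gt : 3.135494 < Real.log 23 := by
  have h := log_add_le_log (q := 45 / 2) (w := 23) (by norm_num) (by norm_num)
  have e : Real.log (45 / 2) = 2 * Real.log 3 + Real.log 5 - Real.log 2 := by
    rw [show (45 / 2 : ℝ) = 3 ^ 2 * 5 / 2 by norm_num, Real.log_div (by norm_num) (by norm_num),
      Real.log_mul (by norm_num) (by norm_num), Real.log_pow]
    norm_num
  rw [e] at h
  have := Real.log_two_lt_d9
  have := Real.log_three_gt_d9
  have := Real.log_five_gt_d9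
  norm_num at *
  linarith

theorem log_primorial_23_gt : 19.223097 < Real.log 223092870 := by
  have h := log_add_le_log (q := 2 ^ 18 * 3 ^ 12 / 5 ^ 4) (w := 223092870)
    (by norm_num) (by norm_num)
  rw [Real.log_div (by norm_num) (by norm_num), Real.log_mul (by norm_num) (by norm_num),
    Real.log_pow, Real.log_pow, Real.log_pow] at h
  have := Real.log_two_gt_d9
  have := Real.log_three_gt_d9
  have := Real.log_five_lt_d9
  norm_num at *
  linarith

theorem log_19_223097_lt : Real.log 19.223097 < 2.956114 := by
  have h := log_add_le (A := 2 ^ 5 * 3 / 5) (a := 0.023097) (by norm_num) (by norm_num)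
  rw [Real.log_div (by norm_num) (by norm_num), Real.log_mul (by norm_num) (by norm_num),
    Real.log_pow] at h
  have := Real.log_two_lt_d9
  have := Real.log_three_lt_d9
  have := Real.log_five_gt_d9
  norm_num at *
  linarith

theorem primeDeficit_23 (y : ℝ) : primeDeficit 23 y = 9 * y - Real.log 223092870 := by
  have e : Real.log 223092870 = Real.log 2 + Real.log 3 + Real.log 5 + Real.log 7 + Real.log 11 +
      Real.log 13 + Real.log 17 + Real.log 19 + Real.log 23 := by
    repeat rw [← Real.log_mul (by norm_num) (by norm_num)]
    norm_num
  rw [e, primeDeficit, ← Finset.sum_filter,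
    show (Finset.range (23 + 1)).filter Nat.Prime = {2, 3, 5, 7, 11, 13, 17, 19, 23} by decide]
  norm_num
  ring

theorem scanInv_23 : ScanInv 23 23 9 3135494000000 19223097000000 2956114000000 where
  odd := by decide
  three_le := by norm_num
  le := le_rfl
  one_le := by norm_num
  pos := by norm_num
  log_q := by have := log_23_gt; norm_num at *; linarith
  le_A := by norm_num
  log_A := by have := log_19_223097_lt; norm_num at *; linarith
  deficit y _ := by
    have := log_primorial_23_gt
    rw [primeDeficit_23]
    norm_num at *
    linarith

theorem gcd_factorial_eq_one {m p : ℕ} (hp : p.Prime) (h : m < p) : p.gcd m.factorial = 1 :=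
  hp.coprime_factorial_of_lt h

set_option maxRecDepth 100000 in
theorem scan_23_401 : (force (Nat.factorial 22) fun P ↦
    scan P 401 401 79 5993949530853 376726318573028 5931534236486 189
      23 23 9 3135494000000 19223097000000 2956114000000) = true := by
  decide +kernel

theorem scanInv_401 :
    ScanInv 401 401 79 5993949530853 376726318573028 5931534236486 ∧
      ∀ j, 9 < j → j ≤ 79 → OmegaBound j := by
  have h := scan_23_401
  rw [force_eq] at h
  exact scanInv_23.of_scan _ (fun p hp hm ↦ gcd_factorial_eq_one hp (by lia)) h

set_option maxRecDepth 100000 in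
theorem scan_401_16385 : (force (Nat.factorial 269) fun P ↦
    scan P 16385 16381 1900 9703865505745 16255065526268459 9696175126452 7992
      401 401 79 5993949530853 376726318573028 5931534236486) = true := by
  decide +kernel

theorem scanInv_16385 :
    ScanInv 16385 16381 1900 9703865505745 16255065526268459 9696175126452 ∧
      ∀ j, 9 < j → j ≤ 1900 → OmegaBound j := by
  have h := scan_401_16385
  rw [force_eq] at h
  have h' := scanInv_401.1.of_scan _ (fun p hp hm ↦ gcd_factorial_eq_one hp (by lia)) h
  exact ⟨h'.1, fun j h1 h2 ↦ (Nat.lt_or_ge 79 j).elim (fun hj ↦ h'.2 j hj h2)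
    (scanInv_401.2 j h1)⟩

set_option maxRecDepth 100000 in
theorem scan_16385_32769 : (force (Nat.factorial 269) fun P ↦
    scan P 32769 32749 3512 10396615804877 32514788982753636 10389465576214 8192
      16385 16381 1900 9703865505745 16255065526268459 9696175126452) = true := by
  decide +kernel

theorem scanInv_32769 :
    ScanInv 32769 32749 3512 10396615804877 32514788982753636 10389465576214 ∧
      ∀ j, 9 < j → j ≤ 3512 → OmegaBound j := by
  have h := scan_16385_32769
  rw [force_eq] at h
  have h' := scanInv_16385.1.of_scan _ (fun p hp hm ↦ gcd_factorial_eq_one hp (by lia)) h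
  exact ⟨h'.1, fun j h1 h2 ↦ (Nat.lt_or_ge 1900 j).elim (fun hj ↦ h'.2 j hj h2)
    (scanInv_16385.2 j h1)⟩

set_option maxRecDepth 100000 in
theorem scan_32769_49153 : (force (Nat.factorial 269) fun P ↦
    scan P 49153 49139 5051 10802396393192 48845441121659168 10796431598022 8192
      32769 32749 3512 10396615804877 32514788982753636 10389465576214) = true := by
  decide +kernel

theorem scanInv_49153 :
    ScanInv 49153 49139 5051 10802396393192 48845441121659168 10796431598022 ∧
      ∀ j, 9 < j → j ≤ 5051 → OmegaBound j := by
  have h := scan_32769_49153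
  rw [force_eq] at h
  have h' := scanInv_32769.1.of_scan _ (fun p hp hm ↦ gcd_factorial_eq_one hp (by lia)) h
  exact ⟨h'.1, fun j h1 h2 ↦ (Nat.lt_or_ge 3512 j).elim (fun hj ↦ h'.2 j hj h2)
    (scanInv_32769.2 j h1)⟩

set_option maxRecDepth 100000 in
theorem scan_49153_65535 : (force (Nat.factorial 269) fun P ↦
    scan P 65535 65521 6542 11090114077085 65174184294407782 11084833994843 8191
      49153 49139 5051 10802396393192 48845441121659168 10796431598022) = true := by
  decide +kernel

theorem scanInv_65535 :
    ScanInv 65535 65521 6542 11090114077085 65174184294407782 11084833994843 ∧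
      ∀ j, 9 < j → j ≤ 6542 → OmegaBound j := by
  have h := scan_49153_65535
  rw [force_eq] at h
  have h' := scanInv_49153.1.of_scan _ (fun p hp hm ↦ gcd_factorial_eq_one hp (by lia)) h
  exact ⟨h'.1, fun j h1 h2 ↦ (Nat.lt_or_ge 5051 j).elim (fun hj ↦ h'.2 j hj h2)
    (scanInv_49153.2 j h1)⟩

set_option maxRecDepth 100000 in
theorem scan_65535_71999 : (force (Nat.factorial 269) fun P ↦
    scan P 71999 71999 7128 11184395604727 71701218373808101 11180278292091 3232
      65535 65521 6542 11090114077085 65174184294407782 11084833994843) = true := by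
  decide +kernel

theorem scanInv_71999 :
    ScanInv 71999 71999 7128 11184395604727 71701218373808101 11180278292091 ∧
      ∀ j, 9 < j → j ≤ 7128 → OmegaBound j := by
  have h := scan_65535_71999
  rw [force_eq] at h
  have h' := scanInv_65535.1.of_scan _ (fun p hp hm ↦ gcd_factorial_eq_one hp (by lia)) h
  exact ⟨h'.1, fun j h1 h2 ↦ (Nat.lt_or_ge 6542 j).elim (fun hj ↦ h'.2 j hj h2)
    (scanInv_65535.2 j h1)⟩

theorem omegaBound_of_mem_Icc {k : ℕ} (h9 : 9 ≤ k) (h : k ≤ 7128) : OmegaBound k := by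
  rcases h9.eq_or_lt with rfl | h9
  · exact scanInv_23.omegaBound (by norm_num)
  · exact scanInv_71999.2 k h9 h

open ArithmeticFunction in
theorem log_factorial_eq_sum_vonMangoldt (N : ℕ) :
    Real.log N.factorial = ∑ n ∈ Finset.Ioc 0 N, vonMangoldt n * (N / n : ℕ) := by
  rw [← sum_Ioc_mul_zeta_eq_sum, vonMangoldt_mul_zeta]
  induction N with
  | zero => simp
  | succ N ih =>
    rw [Finset.sum_Ioc_succ_top N.zero_le, ← ih, Nat.factorial_succ, Nat.cast_mul,
      Real.log_mul (by positivity) (by exact_mod_cast N.factorial_ne_zero), add_comm, log_apply]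

/-- The divisors `d` entering `chebyshevCount` with a plus sign. -/
def plusDivisors : Finset ℕ := {1, 10, 14, 21, 30}

/-- The divisors `d` entering `chebyshevCount` with a minus sign. -/
def minusDivisors : Finset ℕ := {2, 3, 5, 7, 20, 42, 420}

/-- A combination of the step functions `m / d` whose main terms cancel. -/
def chebyshevCount (m : ℕ) : ℤ :=
  ∑ d ∈ plusDivisors, ((m / d : ℕ) : ℤ) - ∑ d ∈ minusDivisors, ((m / d : ℕ) : ℤ)

theorem chebyshevCount_add (m : ℕ) : chebyshevCount (m + 420) = chebyshevCount m := by
  have h (d c : ℤ) (hd : d ≠ 0) (hdc : d * c = 420) : ((m : ℤ) + 420) / d = m / d + c := by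
    rw [← hdc, Int.add_mul_ediv_left _ _ hd]
  simp [chebyshevCount, plusDivisors, minusDivisors, h 2 210, h 3 140, h 5 84, h 7 60, h 10 42,
    h 14 30, h 20 21, h 21 20, h 30 14, h 42 10, h 420 1]
  ring

theorem chebyshevCount_nonneg (m : ℕ) : 0 ≤ chebyshevCount m := by
  induction m using Nat.strong_induction_on with
  | _ m ih =>
    rcases Nat.lt_or_ge m 420 with h | h
    · have : ∀ r < 420, 0 ≤ chebyshevCount r := by decide +kernel
      exact this m h
    · obtain ⟨r, rfl⟩ := Nat.exists_eq_add_of_le' h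
      rw [chebyshevCount_add]
      exact ih r (by lia)

theorem one_le_chebyshevCount {m : ℕ} (h : 0 < m) (h' : m < 6) : 1 ≤ chebyshevCount m := by
  interval_cases m <;> decide

open ArithmeticFunction in
theorem log_factorial_div_eq_sum_vonMangoldt (X d : ℕ) :
    Real.log (X / d).factorial = ∑ n ∈ Finset.Ioc 0 X, vonMangoldt n * (X / n / d : ℕ) := by
  rw [log_factorial_eq_sum_vonMangoldt]
  refine (Finset.sum_subset (Finset.Ioc_subset_Ioc_right (Nat.div_le_self X d))
    fun n hn hn' ↦ ?_).trans (Finset.sum_congr rfl fun n _ ↦ ?_)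
  · simp only [Finset.mem_Ioc] at hn hn'
    rw [Nat.div_eq_of_lt (by lia), Nat.cast_zero, mul_zero]
  · rw [Nat.div_div_eq_div_mul, Nat.div_div_eq_div_mul, mul_comm d]

open ArithmeticFunction Chebyshev in
theorem theta_sub_theta_div_six_le (X : ℕ) : theta X - theta (X / 6 : ℕ) ≤
    ∑ d ∈ plusDivisors, Real.log (X / d).factorial -
      ∑ d ∈ minusDivisors, Real.log (X / d).factorial := by
  have hsum : ∑ d ∈ plusDivisors, Real.log (X / d).factorial -
      ∑ d ∈ minusDivisors, Real.log (X / d).factorial =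
      ∑ n ∈ Finset.Ioc 0 X, vonMangoldt n * chebyshevCount (X / n) := by
    simp_rw [log_factorial_div_eq_sum_vonMangoldt, chebyshevCount]
    rw [Finset.sum_comm, Finset.sum_comm (s := minusDivisors), ← Finset.sum_sub_distrib]
    refine Finset.sum_congr rfl fun n _ ↦ ?_
    rw [← Finset.mul_sum, ← Finset.mul_sum, ← mul_sub, Int.cast_sub, Int.cast_sum,
      Int.cast_sum]
    simp_rw [Int.cast_natCast]
  have htheta : theta X - theta (X / 6 : ℕ) =
      ∑ p ∈ Finset.Ioc 0 X with X / 6 < p ∧ p.Prime, Real.log p := by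
    rw [theta, theta, Nat.floor_natCast, Nat.floor_natCast, sub_eq_iff_eq_add,
      ← Finset.sum_union]
    · congr 1
      ext p
      simp only [Finset.mem_filter, Finset.mem_union, Finset.mem_Ioc]
      have := Nat.div_le_self X 6
      rcases Nat.lt_or_ge (X / 6) p with h | h <;> constructor <;> intro <;> grind
    · rw [Finset.disjoint_left]
      intro p
      simp only [Finset.mem_filter, Finset.mem_Ioc]
      lia
  rw [hsum, htheta, Finset.sum_filter]
  refine Finset.sum_le_sum fun n hn ↦ ?_
  rw [Finset.mem_Ioc] at hn
  split_ifs with h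
  · rw [vonMangoldt_apply_prime h.2]
    have h1 : (1 : ℝ) ≤ chebyshevCount (X / n) := by
      exact_mod_cast one_le_chebyshevCount (Nat.div_pos hn.2 hn.1)
        (by rw [Nat.div_lt_iff_lt_mul hn.1]; lia)
    exact le_mul_of_one_le_right (Real.log_natCast_nonneg n) h1
  · exact mul_nonneg vonMangoldt_nonneg (by exact_mod_cast chebyshevCount_nonneg _)

theorem log_factorial_le {N : ℕ} (hN : 1 ≤ N) :
    Real.log N.factorial ≤ N * Real.log N - N + Real.log N / 2 + 1 := by
  induction N, hN using Nat.le_induction with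
  | base => simp
  | succ N hN ih =>
    have hN' : (0 : ℝ) < N := by exact_mod_cast hN
    have h := log_add_le_log (q := N) (w := N + 1) hN' (by linarith)
    have h2 : 0 ≤ 2 * ((N : ℝ) + 1 - N) ^ 3 / (3 * (N + 1 + N) ^ 3) := by
      rw [add_sub_cancel_left]; positivity
    have h3 : (2 * N + 1) * (2 * ((N : ℝ) + 1 - N) / (N + 1 + N)) = 2 := by
      rw [add_sub_cancel_left]; field_simp; ring
    have h4 : (2 * N + 1) * (2 * ((N : ℝ) + 1 - N) / (N + 1 + N)) ≤
        (2 * N + 1) * (Real.log (N + 1) - Real.log N) :=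
      mul_le_mul_of_nonneg_left (by linarith) (by positivity)
    rw [Nat.factorial_succ, Nat.cast_mul, Real.log_mul (by positivity)
      (by exact_mod_cast N.factorial_ne_zero)]
    push_cast
    linarith

theorem mul_log_sub_mono {z w : ℝ} (hz : 1 ≤ z) (hw : z ≤ w) :
    z * Real.log z - z ≤ w * Real.log w - w := by
  have h := Real.log_le_sub_one_of_pos (x := z / w) (div_pos (by linarith) (by linarith))
  rw [Real.log_div (by linarith) (by linarith)] at h
  have h1 := mul_le_mul_of_nonneg_left h (by linarith : 0 ≤ w)
  have h2 : w * (z / w - 1) = z - w := by field_simp [(by linarith : w ≠ 0)]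
  have h3 := mul_nonneg (sub_nonneg.2 hw) (Real.log_nonneg hz)
  linarith

theorem log_factorial_floor_le {z : ℝ} (hz : 1 ≤ z) :
    Real.log (⌊z⌋₊).factorial ≤ z * Real.log z - z + Real.log z / 2 + 1 := by
  have hN : 1 ≤ ⌊z⌋₊ := by simpa using hz
  have hN' : (1 : ℝ) ≤ ⌊z⌋₊ := by exact_mod_cast hN
  have hle := Nat.floor_le (by linarith : 0 ≤ z)
  have := log_factorial_le hN
  have := mul_log_sub_mono hN' hle
  have := Real.log_le_log (by linarith) hle
  linarith

theorem le_log_factorial_floor {z : ℝ} (hz : 1 ≤ z) :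
    z * Real.log z - z - Real.log z / 2 + 0.55 ≤ Real.log (⌊z⌋₊).factorial := by
  set N := ⌊z⌋₊ with hN
  have hlt : z ≤ (N + 1 : ℕ) := by push_cast; exact (Nat.lt_floor_add_one z).le
  have hle : (N : ℝ) ≤ z := Nat.floor_le (by linarith)
  have h := Stirling.le_log_factorial_stirling (n := N + 1) (by lia)
  have hfac : Real.log (N + 1).factorial = Real.log (N + 1 : ℕ) + Real.log N.factorial := by
    rw [Nat.factorial_succ, Nat.cast_mul, Real.log_mul (by positivity)
      (by exact_mod_cast N.factorial_ne_zero)]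
  have h1 := mul_log_sub_mono hz hlt
  have h2 : Real.log (N + 1 : ℕ) ≤ Real.log 2 + Real.log z := by
    rw [← Real.log_mul (by norm_num) (by linarith)]
    refine Real.log_le_log (by positivity) ?_
    push_cast; linarith
  have h3 : 2 * Real.log 5 - 2 * Real.log 2 ≤ Real.log (2 * Real.pi) := by
    have h6 : Real.log (5 ^ 2 / 2 ^ 2) ≤ Real.log (2 * Real.pi) :=
      Real.log_le_log (by norm_num) (by linarith [Real.pi_gt_d2])
    rw [Real.log_div (by norm_num) (by norm_num), Real.log_pow, Real.log_pow] at h6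
    exact_mod_cast h6
  have := Real.log_two_lt_d9
  have := Real.log_five_gt_d9
  linarith

theorem log_factorial_div_le {X d : ℕ} (hd : 0 < d) (h : d ≤ X) :
    Real.log (X / d).factorial ≤
      X / d * (Real.log X - Real.log d) - X / d + (Real.log X - Real.log d) / 2 + 1 := by
  have hd' : (0 : ℝ) < d := by exact_mod_cast hd
  have h' : (d : ℝ) ≤ X := by exact_mod_cast h
  have := log_factorial_floor_le (z := X / d) (by rwa [one_le_div hd'])
  rwa [Nat.floor_div_eq_div, Real.log_div (by linarith) hd'.ne'] at this

theorem le_log_factorial_div {X d : ℕ} (hd : 0 < d) (h : d ≤ X) :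
    X / d * (Real.log X - Real.log d) - X / d - (Real.log X - Real.log d) / 2 + 0.55 ≤
      Real.log (X / d).factorial := by
  have hd' : (0 : ℝ) < d := by exact_mod_cast hd
  have h' : (d : ℝ) ≤ X := by exact_mod_cast h
  have := le_log_factorial_floor (z := X / d) (by rwa [one_le_div hd'])
  rwa [Nat.floor_div_eq_div, Real.log_div (by linarith) hd'.ne'] at this

theorem log_seven_lt : Real.log 7 < 1.945910172 := by
  have h := log_add_le_log (q := 7 ^ 2) (w := 2 * 5 ^ 2) (by norm_num) (by norm_num)
  rw [Real.log_mul (by norm_num) (by norm_num), Real.log_pow, Real.log_pow] at h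
  have := Real.log_two_lt_d9
  have := Real.log_five_lt_d9
  norm_num at *
  linarith

theorem log_seven_gt : 1.93 < Real.log 7 := by
  have h : Real.log (2 ^ 4 * 3) ≤ Real.log (7 ^ 2) :=
    Real.log_le_log (by norm_num) (by norm_num)
  rw [Real.log_mul (by norm_num) (by norm_num), Real.log_pow, Real.log_pow] at h
  have := Real.log_two_gt_d9
  have := Real.log_three_gt_d9
  norm_num at *
  linarith

open Chebyshev in
theorem theta_sub_theta_div_six_le_of_le {X : ℕ} (h : 420 ≤ X) :
    theta X - theta (X / 6 : ℕ) ≤ 0.8887 * X + 6 * Real.log X - 13 := by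
  have hp (f : ℕ → ℝ) : ∑ d ∈ plusDivisors, f d = f 1 + f 10 + f 14 + f 21 + f 30 := by
    simp [plusDivisors]; ring
  have hm (f : ℕ → ℝ) :
      ∑ d ∈ minusDivisors, f d = f 2 + f 3 + f 5 + f 7 + f 20 + f 42 + f 420 := by
    simp [minusDivisors]; ring
  have hX := theta_sub_theta_div_six_le X
  rw [hp, hm] at hX
  have h1 := log_factorial_div_le (X := X) (d := 1) (by norm_num) (by lia)
  have h10 := log_factorial_div_le (X := X) (d := 10) (by norm_num) (by lia)
  have h14 := log_factorial_div_le (X := X) (d := 14) (by norm_num) (by lia)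
  have h21 := log_factorial_div_le (X := X) (d := 21) (by norm_num) (by lia)
  have h30 := log_factorial_div_le (X := X) (d := 30) (by norm_num) (by lia)
  have h2 := le_log_factorial_div (X := X) (d := 2) (by norm_num) (by lia)
  have h3 := le_log_factorial_div (X := X) (d := 3) (by norm_num) (by lia)
  have h5 := le_log_factorial_div (X := X) (d := 5) (by norm_num) (by lia)
  have h7 := le_log_factorial_div (X := X) (d := 7) (by norm_num) (by lia)
  have h20 := le_log_factorial_div (X := X) (d := 20) (by norm_num) (by lia)
  have h42 := le_log_factorial_div (X := X) (d := 42) (by norm_num) (by lia)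
  have h420 := le_log_factorial_div (X := X) (d := 420) (by norm_num) (by lia)
  have e (a b : ℕ) (ha : a ≠ 0) (hb : b ≠ 0) :
      Real.log ((a * b : ℕ) : ℝ) = Real.log a + Real.log b := by
    rw [Nat.cast_mul, Real.log_mul (by exact_mod_cast ha) (by exact_mod_cast hb)]
  have e10 := e 2 5 (by norm_num) (by norm_num)
  have e14 := e 2 7 (by norm_num) (by norm_num)
  have e21 := e 3 7 (by norm_num) (by norm_num)
  have e30 := e 3 10 (by norm_num) (by norm_num)
  have e20 := e 2 10 (by norm_num) (by norm_num)
  have e42 := e 2 21 (by norm_num) (by norm_num)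
  have e420 := e 42 10 (by norm_num) (by norm_num)
  norm_num only [Nat.cast_ofNat, Nat.cast_one, Real.log_one] at *
  rw [e10] at h10 e30 e20 e420
  rw [e14] at h14
  rw [e21] at h21 e42
  rw [e30] at h30
  rw [e20] at h20
  rw [e42] at h42 e420
  rw [e420] at h420
  have b2 := Real.log_two_gt_d9
  have b2' := Real.log_two_lt_d9
  have b3 := Real.log_three_gt_d9
  have b3' := Real.log_three_lt_d9
  have b5 := Real.log_five_gt_d9
  have b5' := Real.log_five_lt_d9
  have b7 := log_seven_gt
  have b7' := log_seven_lt
  generalize Real.log 2 = l2, Real.log 3 = l3, Real.log 5 = l5, Real.log 7 = l7 at *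
  have hA : -((l2 + l5) / 10 + (l2 + l7) / 14 + (l3 + l7) / 21 + (l3 + (l2 + l5)) / 30)
      + (l2 / 2 + l3 / 3 + l5 / 5 + l7 / 7 + (l2 + (l2 + l5)) / 20 + (l2 + (l3 + l7)) / 42
      + ((l2 + (l3 + l7)) + (l2 + l5)) / 420) ≤ 0.8887 := by
    norm_num at *
    linarith
  have hXA := mul_le_mul_of_nonneg_left hA (Nat.cast_nonneg (α := ℝ) X)
  norm_num at *
  linarith

open Chebyshev in
theorem theta_natCast_le (X : ℕ) (h : 1 ≤ X) :
    theta X ≤ 1.06644 * X + 1.7 * Real.log X ^ 2 + 135 := by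
  induction X using Nat.strong_induction_on with
  | _ X ih =>
    have hlog : 0 ≤ Real.log X := Real.log_natCast_nonneg X
    rcases Nat.lt_or_ge X 420 with hX | hX
    · have h4 := theta_le_log4_mul_x (Nat.cast_nonneg (α := ℝ) X)
      have e : Real.log 4 = 2 * Real.log 2 := by
        rw [show (4 : ℝ) = 2 ^ 2 by norm_num, Real.log_pow]; norm_num
      have hX' : (X : ℝ) ≤ 420 := by exact_mod_cast hX.le
      have := mul_le_mul_of_nonneg_right (Real.log_two_lt_d9.le) (Nat.cast_nonneg (α := ℝ) X)
      rw [e] at h4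
      have := sq_nonneg (Real.log X)
      linarith
    · have h6 : 1 ≤ X / 6 := by lia
      have hi := ih (X / 6) (by lia) h6
      have hs := theta_sub_theta_div_six_le_of_le hX
      have hd : ((X / 6 : ℕ) : ℝ) ≤ X / 6 := by exact_mod_cast natCast_div_le_real X 6
      have hl : Real.log (X / 6 : ℕ) ≤ Real.log X - (Real.log 2 + Real.log 3) := by
        rw [← Real.log_mul (by norm_num) (by norm_num),
          ← Real.log_div (by exact_mod_cast (by lia)) (by norm_num)]
        refine Real.log_le_log (by exact_mod_cast h6) (hd.trans (by norm_num))
      have hl0 : 0 ≤ Real.log (X / 6 : ℕ) := Real.log_natCast_nonneg _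
      have hsq := pow_le_pow_left₀ hl0 hl 2
      have b2 := Real.log_two_gt_d9
      have b2' := Real.log_two_lt_d9
      have b3 := Real.log_three_gt_d9
      have b3' := Real.log_three_lt_d9
      set s := Real.log 2 + Real.log 3 with hs'
      have hs1 : 1.7917 ≤ s := by norm_num at *; linarith
      have hs2 : s ≤ 1.7918 := by norm_num at *; linarith
      have h1 := mul_le_mul_of_nonneg_right hs1 hlog
      have h2 : s ^ 2 ≤ 1.7918 ^ 2 := pow_le_pow_left₀ (by norm_num at *; linarith) hs2 2
      norm_num at *
      nlinarith

open Chebyshev in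
theorem theta_le_of_65536_le {t : ℝ} (ht : 65536 ≤ t) : theta t ≤ 1.072 * t := by
  have hN : 65536 ≤ ⌊t⌋₊ := Nat.le_floor (by exact_mod_cast ht)
  have hN' : (65536 : ℝ) ≤ ⌊t⌋₊ := by exact_mod_cast hN
  have hle : (⌊t⌋₊ : ℝ) ≤ t := Nat.floor_le (by linarith)
  have h := theta_natCast_le ⌊t⌋₊ (by lia)
  rw [theta_eq_theta_coe_floor]
  generalize (⌊t⌋₊ : ℝ) = x at *
  set r := √(x / 65536) with hr
  have hr2 : r ^ 2 = x / 65536 := Real.sq_sqrt (by positivity)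
  have hr1 : 1 ≤ r := by rw [hr, Real.one_le_sqrt]; linarith
  have hx : x = 2 ^ 16 * r ^ 2 := by rw [hr2]; ring
  have hlog : Real.log x = 16 * Real.log 2 + 2 * Real.log r := by
    rw [hx, Real.log_mul (by norm_num) (by positivity), Real.log_pow, Real.log_pow]
    norm_num
  have hlr := Real.log_le_sub_one_of_pos (by linarith : 0 < r)
  have hlr0 := Real.log_nonneg hr1
  have b2 := Real.log_two_gt_d9
  have b2' := Real.log_two_lt_d9
  have hl1 : Real.log x ≤ 9.0904 + 2 * r := by norm_num at *; linarith
  have hl0 : 0 ≤ Real.log x := by norm_num at *; linarith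
  have hsq := pow_le_pow_left₀ hl0 hl1 2
  norm_num at *
  nlinarith

open Chebyshev in
theorem primeDeficit_floor_log {x : ℝ} (hx : 2 ≤ x) : primeDeficit ⌊x⌋₊ (Real.log x) =
    Real.log x * ∫ t in 2..x, theta t / (t * Real.log t ^ 2) := by
  have h := primeCounting_eq_theta_div_log_add_integral hx
  have hlog : Real.log x ≠ 0 := (Real.log_pos (by linarith)).ne'
  have hpi : primeDeficit ⌊x⌋₊ (Real.log x) =
      Nat.primeCounting ⌊x⌋₊ * Real.log x - theta x := by
    rw [primeDeficit, ← Finset.sum_filter, Finset.sum_sub_distrib, theta_eq_sum_Icc,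
      Finset.sum_const, nsmul_eq_mul, Nat.primeCounting, Nat.primeCounting',
      Nat.count_eq_card_filter_range, Nat.range_succ_eq_Icc_zero]
  rw [hpi, h]
  field_simp
  ring

theorem sixteen_mul_log_two_le {x : ℝ} (hx : 65536 ≤ x) : 16 * Real.log 2 ≤ Real.log x := by
  have : Real.log (2 ^ 16) ≤ Real.log x := Real.log_le_log (by norm_num) (by linarith)
  rwa [Real.log_pow] at this

/-- The derivative of `t / (log t ^ 2 - 2 * log t - 3.5)` exceeds that of the logarithmic
integral of `1 / log t ^ 2`. -/
theorem one_div_log_sq_le {l : ℝ} (hl : 11.09 ≤ l) :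
    1 / l ^ 2 ≤ (l ^ 2 - 4 * l - 1.5) / (l ^ 2 - 2 * l - 3.5) ^ 2 := by
  have hq : 0 < l ^ 2 - 2 * l - 3.5 := by nlinarith
  rw [div_le_div_iff₀ (by positivity) (by positivity)]
  nlinarith

theorem hasDerivAt_div_log {t : ℝ} (ht : 0 < t)
    (hq : Real.log t ^ 2 - 2 * Real.log t - 3.5 ≠ 0) :
    HasDerivAt (fun t ↦ t / (Real.log t ^ 2 - 2 * Real.log t - 3.5))
      ((Real.log t ^ 2 - 4 * Real.log t - 1.5) /
        (Real.log t ^ 2 - 2 * Real.log t - 3.5) ^ 2) t := by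
  have hlog := Real.hasDerivAt_log ht.ne'
  have h := (hasDerivAt_id t).div (((hlog.pow 2).sub (hlog.const_mul 2)).sub_const 3.5) hq
  refine HasDerivAt.congr_deriv h ?_
  change (1 * (Real.log t ^ 2 - 2 * Real.log t - 3.5) -
      t * (2 * Real.log t ^ 1 * t⁻¹ - 2 * t⁻¹)) /
    (Real.log t ^ 2 - 2 * Real.log t - 3.5) ^ 2 = _
  congr 1
  field_simp
  ring

open Chebyshev in
theorem integral_theta_le {x : ℝ} (hx : 65536 ≤ x) :
    ∫ t in (65536 : ℝ)..x, theta t / (t * Real.log t ^ 2) ≤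
      1.072 * (x / (Real.log x ^ 2 - 2 * Real.log x - 3.5)) -
        1.072 * (65536 / (Real.log 65536 ^ 2 - 2 * Real.log 65536 - 3.5)) := by
  have hl {t : ℝ} (ht : 65536 ≤ t) : 11.09 ≤ Real.log t := by
    have := Real.log_two_gt_d9
    have := sixteen_mul_log_two_le ht
    norm_num at *
    linarith
  have hd {t : ℝ} (ht : 65536 ≤ t) := (hasDerivAt_div_log (t := t) (by linarith)
    (by have := hl ht; nlinarith)).const_mul 1.072
  refine intervalIntegral.integral_le_sub_of_hasDeriv_right_of_le hx
    (fun t ht ↦ (hd ht.1).continuousAt.continuousWithinAt)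
    (fun t ht ↦ (hd ht.1.le).hasDerivWithinAt)
    ((integrableOn_theta_div_id_mul_log_sq x).mono_set (Set.Icc_subset_Icc_left (by norm_num)))
    fun t ht ↦ ?_
  have ht1 := hl ht.1.le
  have ht0 : 0 < t := by linarith [ht.1]
  calc theta t / (t * Real.log t ^ 2) ≤ 1.072 * t / (t * Real.log t ^ 2) := by
        gcongr
        exact theta_le_of_65536_le ht.1.le
    _ = 1.072 * (1 / Real.log t ^ 2) := by field_simp
    _ ≤ _ := mul_le_mul_of_nonneg_left (one_div_log_sq_le ht1) (by norm_num)

theorem primeDeficit_65536 (y : ℝ) : primeDeficit 65536 y = primeDeficit 65535 y := by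
  rw [primeDeficit_succ 65535, if_neg (by norm_num), add_zero]

theorem primeDeficit_floor_log_le {x : ℝ} (hx : 65536 ≤ x) :
    primeDeficit ⌊x⌋₊ (Real.log x) ≤
      Real.log x * (1.072 * (x / (Real.log x ^ 2 - 2 * Real.log x - 3.5)) - 56) := by
  have hint {a b : ℝ} (ha : 2 ≤ a) (hb : a ≤ b) : IntervalIntegrable
      (fun t ↦ Chebyshev.theta t / (t * Real.log t ^ 2)) MeasureTheory.volume a b :=
    (intervalIntegrable_iff_integrableOn_Icc_of_le hb).2
      ((Chebyshev.integrableOn_theta_div_id_mul_log_sq b).mono_set (Set.Icc_subset_Icc_left ha))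
  rw [primeDeficit_floor_log (by linarith), ← intervalIntegral.integral_add_adjacent_intervals
    (hint le_rfl (by norm_num : (2 : ℝ) ≤ 65536)) (hint (by norm_num) hx)]
  have e : Real.log 65536 = 16 * Real.log 2 := by
    rw [show (65536 : ℝ) = 2 ^ 16 by norm_num, Real.log_pow]; norm_num
  have b2 := Real.log_two_gt_d9
  have b2' := Real.log_two_lt_d9
  have h0 := primeDeficit_floor_log (x := 65536) (by norm_num)
  have hd := scanInv_65535.1.deficit (Real.log 65536) (Real.log_le_log (by norm_num) (by norm_num))
  have hi := integral_theta_le hx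
  rw [show ⌊(65536 : ℝ)⌋₊ = 65536 by norm_num, primeDeficit_65536] at h0
  rw [h0] at hd
  have hl0 : 0 ≤ Real.log x := Real.log_nonneg (by linarith)
  refine mul_le_mul_of_nonneg_left ?_ hl0
  rw [e] at hd hi
  set I := ∫ t in (2 : ℝ)..65536, Chebyshev.theta t / (t * Real.log t ^ 2)
  set l := 16 * Real.log 2 with hl
  have hl1 : 11.090354 ≤ l := by norm_num at *; linarith
  have hl2 : l ≤ 11.090355 := by norm_num at *; linarith
  have hI : I ≤ 665.4 := by
    by_contra! hc
    norm_num at *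
    nlinarith
  have hJ : 673.4 ≤ 65536 / (l ^ 2 - 2 * l - 3.5) := by
    have : l ^ 2 ≤ 11.090355 ^ 2 := pow_le_pow_left₀ (by linarith) hl2 2
    rw [le_div_iff₀ (by nlinarith)]
    norm_num at *
    linarith
  norm_num at *
  linarith

/-- If the main inequality on `[log x₀, log T]` holds at a lower bound `u` of `log x₀` with `x`
replaced by `T`, then it holds on the whole interval. -/
theorem quadratic_mul_le {u T l x : ℝ} (hu : 11 ≤ u) (hul : u ≤ l) (hx : 0 ≤ x) (hxT : x ≤ T)
    (h0 : 0 ≤ 3.8563 + 1.1018 * u - 0.1018 * u ^ 2)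
    (h : (3.8563 + 1.1018 * u - 0.1018 * u ^ 2) * T ≤
      52 * (u * (u - 1.1018) * (u ^ 2 - 2 * u - 3.5))) :
    (3.8563 + 1.1018 * l - 0.1018 * l ^ 2) * x ≤
      52 * (l * (l - 1.1018) * (l ^ 2 - 2 * l - 3.5)) := by
  have h1 : 3.8563 + 1.1018 * l - 0.1018 * l ^ 2 ≤ 3.8563 + 1.1018 * u - 0.1018 * u ^ 2 := by
    nlinarith
  have h2 : u ^ 2 - 2 * u - 3.5 ≤ l ^ 2 - 2 * l - 3.5 := by nlinarith
  have h3 : 0 ≤ u ^ 2 - 2 * u - 3.5 := by nlinarith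
  have h4 : u * (u - 1.1018) ≤ l * (l - 1.1018) := by nlinarith
  have h5 : 0 ≤ u * (u - 1.1018) := by nlinarith
  calc _ ≤ (3.8563 + 1.1018 * u - 0.1018 * u ^ 2) * x := mul_le_mul_of_nonneg_right h1 hx
    _ ≤ (3.8563 + 1.1018 * u - 0.1018 * u ^ 2) * T := mul_le_mul_of_nonneg_left hxT h0
    _ ≤ _ := h
    _ ≤ 52 * (l * (l - 1.1018) * (l ^ 2 - 2 * l - 3.5)) :=
      mul_le_mul_of_nonneg_left (mul_le_mul h4 h2 h3 (h5.trans h4)) (by norm_num)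

theorem quadratic_log_mul_le {x : ℝ} (hx : 65536 ≤ x) :
    (3.8563 + 1.1018 * Real.log x - 0.1018 * Real.log x ^ 2) * x ≤
      52 * (Real.log x * (Real.log x - 1.1018) * (Real.log x ^ 2 - 2 * Real.log x - 3.5)) := by
  have b2 := Real.log_two_gt_d9
  have b3 := Real.log_three_gt_d9
  have hl (a b : ℕ) (h : (2 : ℝ) ^ a * 3 ^ b ≤ x) :
      a * 0.69314 + b * 1.0986 ≤ Real.log x := by
    have := Real.log_le_log (by positivity) h
    rw [Real.log_mul (by positivity) (by positivity), Real.log_pow, Real.log_pow] at this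
    have h1 := mul_le_mul_of_nonneg_left (by linarith : 0.69314 ≤ Real.log 2)
      (Nat.cast_nonneg (α := ℝ) a)
    have h2 := mul_le_mul_of_nonneg_left (by linarith : 1.0986 ≤ Real.log 3)
      (Nat.cast_nonneg (α := ℝ) b)
    linarith
  have hx0 : 0 ≤ x := by linarith
  rcases le_total x (2 ^ 17) with h | h
  · exact quadratic_mul_le (by norm_num) (hl 16 0 (by linarith)) hx0 h
      (by norm_num) (by norm_num)
  have h17 := hl 17 0 (by linarith)
  rcases le_total x (2 ^ 16 * 3) with h | h
  · exact quadratic_mul_le (by norm_num) h17 hx0 h (by norm_num) (by norm_num)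
  have h163 := hl 16 1 (by linarith)
  rcases le_total x (2 ^ 18) with h | h
  · exact quadratic_mul_le (by norm_num) h163 hx0 h (by norm_num) (by norm_num)
  have h18 := hl 18 0 (by linarith)
  rcases le_total x (2 ^ 17 * 3) with h | h
  · exact quadratic_mul_le (by norm_num) h18 hx0 h (by norm_num) (by norm_num)
  have h173 := hl 17 1 (by linarith)
  rcases le_total x (2 ^ 18 * 3) with h | h
  · exact quadratic_mul_le (by norm_num) h173 hx0 h (by norm_num) (by norm_num)
  have h183 := hl 18 1 (by linarith)
  rcases le_total x (2 ^ 20) with h | h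
  · exact quadratic_mul_le (by norm_num) h183 hx0 h (by norm_num) (by norm_num)
  have h20 := hl 20 0 (by linarith)
  generalize Real.log x = l at *
  norm_num at h20
  have h1 : 3.8563 + 1.1018 * l - 0.1018 * l ^ 2 ≤ 0 := by nlinarith
  have h2 : 0 ≤ l * (l - 1.1018) := by nlinarith
  have h3 : 0 ≤ l ^ 2 - 2 * l - 3.5 := by nlinarith
  have := mul_nonneg h2 h3
  have := mul_nonpos_of_nonpos_of_nonneg h1 hx0
  linarith

theorem omegaBound_of_lt {k : ℕ} (hk : 7128 < k) : OmegaBound k := by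
  intro n hn hcard
  have hk' : (7128 : ℝ) ≤ k := by exact_mod_cast hk.le
  have hL : 71701 ≤ Real.log n := by
    have h1 := scanInv_71999.1.deficit (Real.log 71999) (by norm_num)
    have h2 := card_mul_sub_log_le_primeDeficit (m := 71999) (y := Real.log 71999) hn (by norm_num)
      (Real.log_le_log (by norm_num) (by norm_num))
    rw [hcard] at h2
    have h3 := mul_le_mul_of_nonneg_right hk' (Real.log_nonneg (by norm_num : (1 : ℝ) ≤ 71999))
    norm_num at *
    linarith
  obtain ⟨x, hx⟩ : ∃ x, Real.log n = 1.072 * x := ⟨Real.log n / 1.072, by ring⟩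
  rw [hx] at hL
  have hx1 : 65536 ≤ x := by norm_num at *; linarith
  have hp := primeDeficit_floor_log_le hx1
  have hc := card_mul_sub_log_le_primeDeficit (m := ⌊x⌋₊) (y := Real.log x) hn
    (Real.log_le_log (by exact_mod_cast Nat.floor_pos.2 (by linarith)) (Nat.floor_le (by linarith)))
    (Real.log_le_log (by linarith) (Nat.lt_floor_add_one x).le)
  have hN := quadratic_log_mul_le hx1
  have hl : 11 ≤ Real.log x := by
    have := sixteen_mul_log_two_le hx1
    have := Real.log_two_gt_d9
    norm_num at *
    linarith
  have h72 : Real.log 1.072 ≤ 0.0696 := by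
    have := log_add_le (A := 1) (a := 0.072) (by norm_num) (by norm_num)
    norm_num at *
    linarith
  rw [hcard, hx] at hc
  rw [hx, Real.log_mul (by norm_num) (by linarith)]
  generalize Real.log x = l at *
  have hq : 0 < l ^ 2 - 2 * l - 3.5 := by nlinarith
  have hF : x / (l ^ 2 - 2 * l - 3.5) * (l ^ 2 - 2 * l - 3.5) = x := div_mul_cancel₀ _ hq.ne'
  generalize x / (l ^ 2 - 2 * l - 3.5) = F at *
  have hNq : 3.8563 + 1.1018 * l - 0.1018 * l ^ 2 =
      l * (l - 1.1018) - 1.1018 * (l ^ 2 - 2 * l - 3.5) := by ring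
  rw [hNq] at hN
  generalize l ^ 2 - 2 * l - 3.5 = q at *
  have h1 : k * l * ((l - 1.1018) * q) ≤
      (1.072 * x + l * (1.072 * F - 56)) * ((l - 1.1018) * q) :=
    mul_le_mul_of_nonneg_right (by linarith) (mul_nonneg (by linarith) hq.le)
  have h2 : (1.072 * x + l * (1.072 * F - 56)) * ((l - 1.1018) * q) =
      1.072 * x * l * q + 1.072 * ((l * (l - 1.1018) - 1.1018 * q) * x) -
        56 * (l * (l - 1.1018) * q) := by
    linear_combination 1.072 * l * (l - 1.1018) * hF
  have h3 : 0 ≤ l * (l - 1.1018) * q :=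
    mul_nonneg (mul_nonneg (by linarith) (by linarith)) hq.le
  have h4 : k * (l - 1.1018) ≤ 1.072 * x := by
    refine le_of_mul_le_mul_right ?_ (mul_pos (by linarith : 0 < l) hq)
    linarith
  have h5 : (k : ℝ) * (Real.log 1.072 + l - 1.1714) ≤ k * (l - 1.1018) :=
    mul_le_mul_of_nonneg_left (by linarith) (by linarith)
  exact h5.trans h4

theorem omegaBound_of_le {k : ℕ} (hk : k ≤ 8) : OmegaBound k := by
  intro n hn hcard
  have hk' : (k : ℝ) ≤ 8 := by exact_mod_cast hk
  rcases (Real.log_natCast_nonneg n).eq_or_lt with h0 | h0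
  · rw [← h0, Real.log_zero]
    have := Nat.cast_nonneg (α := ℝ) k
    linarith
  · have h := Real.log_le_sub_one_of_pos (x := Real.log n / 2 ^ 3) (by positivity)
    rw [Real.log_div h0.ne' (by norm_num), Real.log_pow] at h
    have := Real.log_two_lt_d9
    have h1 : Real.log (Real.log n) - 1.1714 ≤ Real.log n / 8 := by
      norm_num at *
      linarith
    have h2 := mul_le_mul_of_nonneg_left h1 (Nat.cast_nonneg (α := ℝ) k)
    have h3 := mul_le_mul_of_nonneg_right hk' h0.le
    linarith

theorem omegaBound (k : ℕ) : OmegaBound k := by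
  rcases Nat.lt_or_ge 8 k with h | h
  · rcases Nat.lt_or_ge 7128 k with h' | h'
    · exact omegaBound_of_lt h'
    · exact omegaBound_of_mem_Icc h h'
  · exact omegaBound_of_le h

theorem log_log_gt {n : ℕ} (hn : 26 ≤ n) : 1.1714 < Real.log (Real.log n) := by
  have h1 : Real.log 26 ≤ Real.log n := Real.log_le_log (by norm_num) (by exact_mod_cast hn)
  have h2 := log_add_le_log (q := 5 ^ 2) (w := 26) (by norm_num) (by norm_num)
  have h3 := log_add_le_log (q := 2 ^ 4 / 5) (w := 3.258) (by norm_num) (by norm_num)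
  rw [Real.log_pow] at h2
  rw [Real.log_div (by norm_num) (by norm_num), Real.log_pow] at h3
  have := Real.log_two_gt_d9
  have := Real.log_five_gt_d9
  have := Real.log_five_lt_d9
  have h4 : Real.log 3.258 ≤ Real.log (Real.log n) :=
    Real.log_le_log (by norm_num) (by norm_num at *; linarith)
  norm_num at *
  linarith

/-- **Lemma 2.6** (Robin). For `n ≥ 26`, the number `ω(n)` of distinct prime divisors of `n`
satisfies `ω(n) ≤ log n / (log (log n) − 1.1714)`. -/
theorem primeFactors_card_le_log_div
    (n : ℕ) (hn : 26 ≤ n) :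
    (n.primeFactors.card : ℝ) ≤ Real.log n / (Real.log (Real.log n) - 1.1714) := by
  rw [le_div_iff₀ (sub_pos.2 (log_log_gt hn))]
  exact omegaBound _ n (by lia) rfl
end

section
/- Let G be a finite group acting on two finite sets Ω₁ and Ω₂, and for i = 1, 2 let π_i : G → ℂ denote the permutation character, π_i(h) = |Fix_{Ω_i}(h)|. Suppose that for every irreducible finite-dimensional complex representation W of G with character χ_W, the inner product (1/|G|) ∑_{h ∈ G} π₁(h) · conj(χ_W(h)) is at most (1/|G|) ∑_{h ∈ G} π₂(h) · conj(χ_W(h)) (both inner products are non-negative integers, namely the multiplicities of χ_W in π₁ and π₂). Then for every g ∈ G and every natural number ℓ, if the cyclic subgroup ⟨g⟩ has at least ℓ orbits on Ω₁ of cardinality equal to the order of g, then ⟨g⟩ has at least ℓ orbits on Ω₂ of cardinality equal to the order of g. -/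
open MulAction
open scoped ComplexOrder

namespace Representation

/-- The character of a finite-dimensional representation is the sum of the characters of two
complementary subrepresentations. -/
theorem character_eq_add_of_isCompl {k G V : Type*} [Monoid G] [Field k] [AddCommGroup V]
    [Module k V] [FiniteDimensional k V] {ρ : Representation k G V} {σ τ : Subrepresentation ρ}
    (h : IsCompl σ.toSubmodule τ.toSubmodule) :
    ρ.character = σ.toRepresentation.character + τ.toRepresentation.character := by
  funext x
  have key : ρ x = (Submodule.prodEquivOfIsCompl _ _ h).conj
      ((σ.toRepresentation x).prodMap (τ.toRepresentation x)) := by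
    refine LinearMap.ext fun v => ?_
    obtain ⟨w, rfl⟩ := (Submodule.prodEquivOfIsCompl _ _ h).surjective v
    rw [LinearEquiv.conj_apply_apply, LinearEquiv.symm_apply_apply]
    simp [Subrepresentation.toRepresentation]
  simp only [character, Pi.add_apply]
  rw [key, LinearMap.trace_conj', LinearMap.trace_prodMap']

theorem isCompl_toSubmodule {k G V : Type*} [Monoid G] [Field k] [AddCommGroup V]
    [Module k V] {ρ : Representation k G V} {σ τ : Subrepresentation ρ}
    (h : IsCompl σ τ) : IsCompl σ.toSubmodule τ.toSubmodule :=
  IsCompl.of_eq (congrArg Subrepresentation.toSubmodule h.inf_eq_bot)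
    (congrArg Subrepresentation.toSubmodule h.sup_eq_top)

theorem IsIrreducible.simple_fdRep {k G V : Type} [Group G] [Finite G] [Field k] [CharZero k]
    [IsAlgClosed k] [AddCommGroup V] [Module k V] [FiniteDimensional k V]
    (ρ : Representation k G V) [ρ.IsIrreducible] : CategoryTheory.Simple (FDRep.of ρ) := by
  have := Fintype.ofFinite G
  have := invertibleOfNonzero (NeZero.ne (Nat.card G : k))
  rw [FDRep.simple_iff_char_is_norm_one]
  have h := Representation.char_orthonormal ρ ρ
  rw [if_pos ⟨Representation.Equiv.refl ρ⟩, inv_mul_eq_one₀ (NeZero.ne _)] at h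
  exact h.symm

/-- An additive functional which is non-negative on irreducible characters is non-negative on all
characters. -/
theorem map_character_nonneg {k G M : Type} [Group G] [Finite G] [Field k] [CharZero k]
    [IsAlgClosed k] [AddCommMonoid M] [PartialOrder M] [IsOrderedAddMonoid M] (F : (G → k) →+ M)
    (hF : ∀ W : FDRep k G, CategoryTheory.Simple W → 0 ≤ F W.character)
    {V : Type} [AddCommGroup V] [Module k V] [FiniteDimensional k V]
    (ρ : Representation k G V) : 0 ≤ F ρ.character := by
  induction hn : Module.finrank k V using Nat.strong_induction_on generalizing V with
  | _ n ih =>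
    by_cases hirr : ρ.IsIrreducible
    · exact hF (FDRep.of ρ) (IsIrreducible.simple_fdRep ρ)
    rcases subsingleton_or_nontrivial V with hV | hV
    · have : ρ.character = 0 := by
        funext x
        simp [character, Subsingleton.elim (ρ x) 0]
      simp [this]
    have hnt : Nontrivial (Subrepresentation ρ) :=
      ⟨⊥, ⊤, fun h => bot_ne_top (α := Submodule k V)
        (congrArg Subrepresentation.toSubmodule h)⟩
    obtain ⟨σ, hσ⟩ : ∃ σ : Subrepresentation ρ, ¬ (σ = ⊥ ∨ σ = ⊤) := by
      by_contra! h
      exact hirr ⟨h⟩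
    obtain ⟨τ, hτ⟩ := exists_isCompl σ
    have hc := isCompl_toSubmodule hτ
    rw [character_eq_add_of_isCompl hc, map_add]
    have hdim := Submodule.finrank_add_eq_of_isCompl hc
    have hσ_pos : 0 < Module.finrank k σ.toSubmodule := by
      rw [Nat.pos_iff_ne_zero, Ne, Submodule.finrank_eq_zero]
      exact fun h => hσ (Or.inl (Subrepresentation.toSubmodule_injective h))
    have hτ_pos : 0 < Module.finrank k τ.toSubmodule := by
      rw [Nat.pos_iff_ne_zero, Ne, Submodule.finrank_eq_zero]
      intro h
      rw [Subrepresentation.toSubmodule_injective (a₁ := τ) (a₂ := ⊥) h] at hτ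
      exact hσ (Or.inr (eq_top_of_isCompl_bot hτ))
    exact add_nonneg (ih _ (by omega) σ.toRepresentation rfl)
      (ih _ (by omega) τ.toRepresentation rfl)

section Induced

variable (k G : Type*) [Group G] [Field k]

/-- The left regular representation on functions. -/
def leftRegularFun : Representation k G (G → k) where
  toFun h := LinearMap.funLeft k k (h⁻¹ * ·)
  map_one' := by ext; simp [LinearMap.funLeft]
  map_mul' a b := by ext; simp [LinearMap.funLeft, mul_assoc]

variable {k G}

@[simp]
theorem leftRegularFun_apply (h : G) (f : G → k) (x : G) :
    leftRegularFun k G h f x = f (h⁻¹ * x) := rfl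

/-- The functions `f` on `G` with `f (x * g) = ω * f x`: the representation induced from the
character of `⟨g⟩` determined by `ω`. -/
def eigenfunctions (g : G) (ω : k) : Subrepresentation (leftRegularFun k G) where
  toSubmodule :=
    { carrier := {f | ∀ x, f (x * g) = ω * f x}
      add_mem' := fun ha hb x => by simp [ha x, hb x, mul_add]
      zero_mem' := fun x => by simp
      smul_mem' := fun c f hf x => by simp [hf x, mul_left_comm] }
  apply_mem_toSubmodule h f hf x := by
    simpa [mul_assoc] using hf (h⁻¹ * x)

theorem mem_eigenfunctions {g : G} {ω : k} {f : G → k} :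
    f ∈ (eigenfunctions g ω).toSubmodule ↔ ∀ x, f (x * g) = ω * f x := Iff.rfl

theorem apply_mul_pow_of_mem_eigenfunctions {g : G} {ω : k} {f : G → k}
    (hf : f ∈ (eigenfunctions g ω).toSubmodule) (x : G) (j : ℕ) :
    f (x * g ^ j) = ω ^ j * f x := by
  induction j with
  | zero => simp
  | succ j ih => rw [pow_succ, ← mul_assoc, mem_eigenfunctions.1 hf, ih]; ring

/-- The projection of the functions on `G` onto `eigenfunctions g ω`. -/
noncomputable def eigenprojection (g : G) (ω : k) : (G → k) →ₗ[k] (G → k) :=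
  (orderOf g : k)⁻¹ • ∑ j ∈ Finset.range (orderOf g), (ω⁻¹) ^ j • LinearMap.funLeft k k (· * g ^ j)

theorem eigenprojection_apply (g : G) (ω : k) (f : G → k) (x : G) :
    eigenprojection g ω f x =
      (orderOf g : k)⁻¹ * ∑ j ∈ Finset.range (orderOf g), (ω⁻¹) ^ j * f (x * g ^ j) := by
  simp [eigenprojection, LinearMap.funLeft_apply]

theorem eigenprojection_mem {g : G} {ω : k} (h0 : ω ≠ 0) (hω : ω ^ orderOf g = 1) (f : G → k) :
    eigenprojection g ω f ∈ (eigenfunctions g ω).toSubmodule := by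
  intro x
  simp only [eigenprojection_apply]
  rw [mul_left_comm]
  congr 1
  have h := Finset.sum_range_succ' (fun j => ω * ((ω⁻¹) ^ j * f (x * g ^ j))) (orderOf g)
  rw [Finset.sum_range_succ] at h
  simp only [inv_pow, hω, pow_orderOf_eq_one, pow_zero, inv_one] at h
  rw [add_right_cancel_iff] at h
  simp only [inv_pow]
  rw [Finset.mul_sum, h]
  refine Finset.sum_congr rfl fun j _ => ?_
  rw [mul_assoc, ← pow_succ']
  field_simp
  ring

theorem eigenprojection_of_mem [CharZero k] [Finite G] {g : G} {ω : k} (h0 : ω ≠ 0) {f : G → k}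
    (hf : f ∈ (eigenfunctions g ω).toSubmodule) : eigenprojection g ω f = f := by
  funext x
  have hn : (orderOf g : k) ≠ 0 := Nat.cast_ne_zero.2 (orderOf_pos g).ne'
  simp [eigenprojection_apply, apply_mul_pow_of_mem_eigenfunctions hf, h0, hn]

/-- The Frobenius formula for the character induced from a cyclic subgroup. -/
theorem character_eigenfunctions [CharZero k] [Fintype G] [DecidableEq G] {g : G} {ω : k}
    (h0 : ω ≠ 0) (hω : ω ^ orderOf g = 1) (h : G) :
    (eigenfunctions g ω).toRepresentation.character h =
      (orderOf g : k)⁻¹ * ∑ x : G, ∑ j ∈ Finset.range (orderOf g),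
        (ω⁻¹) ^ j * if x * g ^ j * x⁻¹ = h then 1 else 0 := by
  set U := (eigenfunctions g ω).toSubmodule
  have hmem (f : G → k) : (leftRegularFun k G h ∘ₗ eigenprojection g ω) f ∈ U :=
    (eigenfunctions g ω).apply_mem_toSubmodule h (eigenprojection_mem h0 hω f)
  have h1 : (eigenfunctions g ω).toRepresentation h =
      (LinearMap.codRestrict U _ hmem) ∘ₗ U.subtype := by
    ext f : 2
    exact congrArg (leftRegularFun k G h) (eigenprojection_of_mem h0 f.2).symm
  rw [character, h1, LinearMap.trace_comp_comm', LinearMap.subtype_comp_codRestrict,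
    LinearMap.trace_eq_matrix_trace k (Pi.basisFun k G), Matrix.trace, Finset.mul_sum]
  refine Finset.sum_congr rfl fun x _ => ?_
  simp only [Matrix.diag_apply, LinearMap.toMatrix_apply, Pi.basisFun_apply, Pi.basisFun_repr,
    LinearMap.comp_apply, leftRegularFun_apply, eigenprojection_apply]
  congr 1
  refine Finset.sum_congr rfl fun j _ => ?_
  rw [Pi.single_apply]
  congr 2
  rw [mul_assoc, inv_mul_eq_iff_eq_mul, mul_inv_eq_iff_eq_mul]

end Induced

end Representation

/-- The number of fixed points of `h` is invariant under conjugation. -/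
theorem MulAction.ncard_fixedBy_conj {G Ω : Type*} [Group G] [MulAction G Ω] (x h : G) :
    (fixedBy Ω (x * h * x⁻¹)).ncard = (fixedBy Ω h).ncard := by
  rw [← smul_fixedBy, Set.ncard_smul_set]

/-- A sum over a cycle against a primitive root of unity detects the points of full period. -/
theorem IsPrimitiveRoot.sum_range_ite_dvd {k : Type*} [Field k] {ω : k} {n d : ℕ}
    (hω : IsPrimitiveRoot ω n) (hn : 0 < n) (hd : d ∣ n) :
    (∑ j ∈ Finset.range n, ω ^ j * if d ∣ j then 1 else 0) = if d = n then 1 else 0 := by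
  obtain ⟨m, rfl⟩ := hd
  have hd0 : 0 < d := Nat.pos_of_mul_pos_right hn
  have himg : (Finset.range (d * m)).filter (d ∣ ·) = (Finset.range m).image (d * ·) := by
    ext j
    simp only [Finset.mem_filter, Finset.mem_range, Finset.mem_image]
    constructor
    · rintro ⟨h, i, rfl⟩
      exact ⟨i, lt_of_mul_lt_mul_left h hd0.le, rfl⟩
    · rintro ⟨i, hi, rfl⟩
      exact ⟨Nat.mul_lt_mul_of_pos_left hi hd0, dvd_mul_right _ _⟩
  simp only [mul_ite, mul_one, mul_zero]
  rw [← Finset.sum_filter, himg, Finset.sum_image fun a _ b _ h => Nat.eq_of_mul_eq_mul_left hd0 h]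
  simp only [pow_mul]
  have hprim : IsPrimitiveRoot (ω ^ d) m := hω.pow hn rfl
  split_ifs with h
  · obtain rfl : m = 1 := by simpa [hd0.ne'] using h
    simp
  · refine hprim.geom_sum_eq_zero ?_
    by_contra! hm
    have hm0 : 0 < m := Nat.pos_of_mul_pos_left hn
    exact h (by rw [show m = 1 by omega, mul_one])

namespace MulAction

variable {G Ω : Type*} [Group G] [MulAction G Ω]

theorem ncard_orbit_zpowers (g : G) (a : Ω) :
    (orbit (Subgroup.zpowers g) a).ncard = period g a := by
  rw [← Nat.card_coe_set_eq, Nat.card_congr (orbitZPowersEquiv g a), Nat.card_zmod]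
  rfl

theorem ncard_period_eq_orderOf [Finite Ω] (g : G) :
    {a : Ω | period g a = orderOf g}.ncard =
      {o : orbitRel.Quotient (Subgroup.zpowers g) Ω | o.orbit.ncard = orderOf g}.ncard *
        orderOf g := by
  classical
  have := Fintype.ofFinite Ω
  have := Fintype.ofFinite (orbitRel.Quotient (Subgroup.zpowers g) Ω)
  rw [Set.ncard_eq_toFinset_card', Set.ncard_eq_toFinset_card']
  rw [Finset.card_eq_sum_card_fiberwise
    (f := (Quotient.mk'' : Ω → orbitRel.Quotient (Subgroup.zpowers g) Ω))
    (t := {o : orbitRel.Quotient (Subgroup.zpowers g) Ω | o.orbit.ncard = orderOf g}.toFinset)]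
  · rw [← smul_eq_mul, ← Finset.sum_const]
    refine Finset.sum_congr rfl fun o ho => ?_
    rw [Set.mem_toFinset, Set.mem_ofPred_eq] at ho
    conv_rhs => rw [← ho]
    rw [Set.ncard_eq_toFinset_card']
    congr 1
    ext a
    simp only [Finset.mem_filter, Set.mem_toFinset, Set.mem_ofPred_eq, orbitRel.Quotient.mem_orbit]
    refine ⟨And.right, fun h => ⟨?_, h⟩⟩
    rw [← ncard_orbit_zpowers, ← ho, ← h]
    rfl
  · intro a ha
    simp only [Set.coe_toFinset, Set.mem_ofPred_eq] at ha ⊢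
    rw [← ha, ← ncard_orbit_zpowers]
    rfl

theorem sum_pow_mul_ncard_fixedBy {k : Type*} [Field k] [Finite G] [Finite Ω] (g : G) {ω : k}
    (hω : IsPrimitiveRoot ω (orderOf g)) :
    ∑ j ∈ Finset.range (orderOf g), ω ^ j * ((fixedBy Ω (g ^ j)).ncard : k) =
      {o : orbitRel.Quotient (Subgroup.zpowers g) Ω | o.orbit.ncard = orderOf g}.ncard *
        orderOf g := by
  classical
  have := Fintype.ofFinite Ω
  rw [← Nat.cast_mul, ← ncard_period_eq_orderOf, Set.ncard_eq_toFinset_card', Set.toFinset_ofPred,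
    Finset.natCast_card_filter]
  simp only [← hω.sum_range_ite_dvd (orderOf_pos g) (period_dvd_orderOf g _)]
  rw [Finset.sum_comm]
  refine Finset.sum_congr rfl fun j _ => ?_
  rw [← Finset.mul_sum, ← Finset.natCast_card_filter, Set.ncard_eq_toFinset_card']
  congr 3
  ext a
  simp [pow_smul_eq_iff_period_dvd]

end MulAction

/-- Frobenius reciprocity: the multiplicity in a permutation character of the character induced
from a faithful linear character of `⟨g⟩` is the number of regular orbits of `⟨g⟩`. -/
theorem inner_permChar_character_eigenfunctions {G Ω : Type*} [Group G] [Fintype G] [Finite Ω]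
    [MulAction G Ω] (g : G) {ω : ℂ} (hω : IsPrimitiveRoot ω (orderOf g)) :
    (1 / (Fintype.card G : ℂ)) * ∑ h : G, ((fixedBy Ω h).ncard : ℂ) *
        (starRingEnd ℂ) ((Representation.eigenfunctions g ω).toRepresentation.character h) =
      {o : orbitRel.Quotient (Subgroup.zpowers g) Ω | o.orbit.ncard = orderOf g}.ncard := by
  classical
  have hn : (orderOf g : ℂ) ≠ 0 := Nat.cast_ne_zero.2 (orderOf_pos g).ne'
  have hG : (Fintype.card G : ℂ) ≠ 0 := Nat.cast_ne_zero.2 Fintype.card_ne_zero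
  have hconj : (starRingEnd ℂ) ω⁻¹ = ω := by
    rw [map_inv₀, ← Complex.inv_eq_conj (hω.norm'_eq_one (orderOf_pos g).ne'), inv_inv]
  simp only [Representation.character_eigenfunctions (hω.ne_zero (orderOf_pos g).ne') hω.pow_eq_one,
    map_mul, map_sum, map_pow, hconj, map_inv₀, Complex.conj_natCast,
    apply_ite (starRingEnd ℂ), map_one, map_zero]
  have key : ∑ h : G, ((fixedBy Ω h).ncard : ℂ) * ((orderOf g : ℂ)⁻¹ *
      ∑ x : G, ∑ j ∈ Finset.range (orderOf g), ω ^ j * if x * g ^ j * x⁻¹ = h then 1 else 0) =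
      (orderOf g : ℂ)⁻¹ * ∑ _x : G, ∑ j ∈ Finset.range (orderOf g),
        ω ^ j * ((fixedBy Ω (g ^ j)).ncard : ℂ) := by
    simp only [mul_left_comm _ (orderOf g : ℂ)⁻¹, ← Finset.mul_sum]
    congr 1
    simp only [Finset.mul_sum]
    rw [Finset.sum_comm]
    refine Finset.sum_congr rfl fun x _ => ?_
    rw [Finset.sum_comm]
    refine Finset.sum_congr rfl fun j _ => ?_
    simp [ncard_fixedBy_conj, mul_comm]
  rw [key, sum_pow_mul_ncard_fixedBy g hω, Finset.sum_const, Finset.card_univ, nsmul_eq_mul]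
  field_simp

open scoped ComplexOrder

/-- **Lemma 5.4** (after Siemons–Zalesskiĭ). Let a finite group `G` act on two finite sets
`Ω₁`, `Ω₂` with permutation characters `π₁`, `π₂`. If `π₁ ≤ π₂`, i.e. for every irreducible
complex representation `W` of `G` the multiplicity `⟨π₁, χ_W⟩` is at most `⟨π₂, χ_W⟩`, then
for every `g ∈ G`: if `⟨g⟩` has at least `ℓ` orbits of cardinality `|g|` on `Ω₁`, then it has
at least `ℓ` orbits of cardinality `|g|` on `Ω₂`. -/
theorem regular_orbits_mono_of_permChar_le
    {G : Type} {Ω₁ Ω₂ : Type*} [Group G] [Fintype G] [Fintype Ω₁] [Fintype Ω₂]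
    [MulAction G Ω₁] [MulAction G Ω₂]
    (hle : ∀ W : FDRep ℂ G, CategoryTheory.Simple W →
      (1 / (Fintype.card G : ℂ)) *
          ∑ h : G, ((MulAction.fixedBy Ω₁ h).ncard : ℂ) * (starRingEnd ℂ) (W.character h) ≤
        (1 / (Fintype.card G : ℂ)) *
          ∑ h : G, ((MulAction.fixedBy Ω₂ h).ncard : ℂ) * (starRingEnd ℂ) (W.character h))
    (g : G) (ℓ : ℕ)
    (h₁ : ℓ ≤ {o : orbitRel.Quotient (Subgroup.zpowers g) Ω₁ | o.orbit.ncard = orderOf g}.ncard) :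
    ℓ ≤ {o : orbitRel.Quotient (Subgroup.zpowers g) Ω₂ | o.orbit.ncard = orderOf g}.ncard := by
  obtain ⟨ω, hω⟩ : ∃ ω : ℂ, IsPrimitiveRoot ω (orderOf g) :=
    ⟨_, Complex.isPrimitiveRoot_exp _ (orderOf_pos g).ne'⟩
  let F : (G → ℂ) →+ ℂ :=
    { toFun := fun χ =>
        (1 / (Fintype.card G : ℂ)) *
            ∑ h : G, ((fixedBy Ω₂ h).ncard : ℂ) * (starRingEnd ℂ) (χ h) -
          (1 / (Fintype.card G : ℂ)) *
            ∑ h : G, ((fixedBy Ω₁ h).ncard : ℂ) * (starRingEnd ℂ) (χ h)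
      map_zero' := by simp
      map_add' := fun χ ψ => by
        simp only [Pi.add_apply, map_add, mul_add, Finset.sum_add_distrib]
        ring }
  have hF := Representation.map_character_nonneg F (fun W hW => sub_nonneg.2 (hle W hW))
    (Representation.eigenfunctions g ω).toRepresentation
  have hcast := sub_nonneg.1 hF
  rw [inner_permChar_character_eigenfunctions g hω,
    inner_permChar_character_eigenfunctions g hω] at hcast
  exact h₁.trans (by exact_mod_cast hcast)
end

section
/- Let F be a finite field with q elements, let V be an F-vector space of finite dimension n, and let x : V ≃ₗ[F] V be a linear automorphism whose order is a prime r not dividing q − 1. Let c be the dimension over F of the fixed subspace {v ∈ V : x v = v}. Then the number of 1-dimensional F-subspaces W of V with x(W) = W equals (q^c − 1)/(q − 1); consequently, the ratio of the number of x-invariant 1-dimensional subspaces to the total number (q^n − 1)/(q − 1) of 1-dimensional subspaces equals (q^c − 1)/(q^n − 1), which is at most q^{−(n−c)}. -/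
open Module

/-- Fraction-free count of the lines contained in a subspace `K`. -/
theorem Submodule.ncard_lines_le_mul {F V : Type*} [Field F] [Finite F] [AddCommGroup V]
    [Module F V] [FiniteDimensional F V] (K : Submodule F V) :
    {W : Submodule F V | finrank F W = 1 ∧ W ≤ K}.ncard * (Nat.card F - 1) =
      Nat.card F ^ finrank F K - 1 := by
  have himage : {W : Submodule F V | finrank F W = 1 ∧ W ≤ K} =
      Submodule.map K.subtype '' {W : Submodule F K | finrank F W = 1} := by
    ext W
    constructor
    · rintro ⟨h1, hle⟩
      have hmap : (W.comap K.subtype).map K.subtype = W := by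
        rw [Submodule.map_comap_subtype, inf_eq_right.mpr hle]
      refine ⟨W.comap K.subtype, ?_, hmap⟩
      rw [Set.mem_ofPred_eq, ← Submodule.finrank_map_subtype_eq K, hmap, h1]
    · rintro ⟨U, hU, rfl⟩
      exact ⟨(Submodule.finrank_map_subtype_eq K U).trans hU, Submodule.map_subtype_le K U⟩
  rw [himage, Set.ncard_image_of_injective _ (Submodule.map_injective_of_injective
    K.injective_subtype), ← Nat.card_coe_set_eq,
    ← Module.natCard_eq_pow_finrank (K := F) (V := K), Projectivization.card F K]
  congr 1
  exact Nat.card_congr (Projectivization.equivSubmodule F K).symm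

/-- An invertible linear map whose order is coprime to `|F| - 1` fixes its invariant lines
pointwise. -/
theorem LinearEquiv.map_eq_self_iff_le_fixed {F V : Type*} [Field F] [Fintype F]
    [AddCommGroup V] [Module F V] (x : V ≃ₗ[F] V)
    (hx : (orderOf x).Coprime (Fintype.card F - 1)) {W : Submodule F V}
    (hW : finrank F W = 1) :
    W.map (x : V →ₗ[F] V) = W ↔ W ≤ LinearMap.ker ((x : V →ₗ[F] V) - LinearMap.id) := by
  constructor
  · intro hinv v hv
    obtain rfl | hv0 := eq_or_ne v 0
    · exact Submodule.zero_mem _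
    have hxv : x v ∈ W := hinv ▸ Submodule.mem_map_of_mem (f := (x : V →ₗ[F] V)) hv
    obtain ⟨a, ha⟩ := (finrank_eq_one_iff_of_nonzero' (⟨v, hv⟩ : W) (by simpa using hv0)).mp hW
      ⟨x v, hxv⟩
    replace ha : a • v = x v := congrArg Subtype.val ha
    have hpow (k : ℕ) : (x ^ k) v = a ^ k • v := by
      induction k with
      | zero => simp
      | succ k ih => rw [pow_succ, LinearEquiv.mul_apply, ← ha, map_smul, ih, smul_smul, pow_succ']
    have hr : a ^ orderOf x = 1 := by
      have h := hpow (orderOf x)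
      rw [pow_orderOf_eq_one, LinearEquiv.coe_one, id_eq] at h
      exact smul_left_injective F hv0 (by simpa using h.symm)
    have ha0 : a ≠ 0 := by
      rintro rfl
      exact hv0 (x.map_eq_zero_iff.mp (by simpa using ha.symm))
    have ha1 : a = 1 := orderOf_eq_one_iff.mp <| Nat.eq_one_of_dvd_coprimes hx
      (orderOf_dvd_of_pow_eq_one hr)
      (orderOf_dvd_of_pow_eq_one (FiniteField.pow_card_sub_one_eq_one a ha0))
    simp [← ha, ha1]
  · intro hle
    have hfix : ∀ v ∈ W, x v = v := fun v hv ↦ by simpa [sub_eq_zero] using hle hv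
    ext v
    constructor
    · rintro ⟨w, hw, rfl⟩
      simpa [hfix w hw] using hw
    · exact fun hv ↦ ⟨v, hv, hfix v hv⟩


/-- **Proposition 5.9** (linear case). Let `F` be a finite field with `q` elements, `V` an
`F`-vector space of dimension `n`, and `x` a linear automorphism of `V` of prime order `r`
with `r ∤ q - 1`. If `c` is the dimension of the fixed subspace of `x`, then the number of
`x`-invariant lines of `V` is `(q^c - 1)/(q - 1)`; consequently the proportion of
`x`-invariant lines among all `(q^n - 1)/(q - 1)` lines equals `(q^c - 1)/(q^n - 1)`, which
is at most `q^{-(n - c)}`. -/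
theorem card_invariant_lines_of_prime_order
    {F V : Type*} [Field F] [Fintype F] [AddCommGroup V] [Module F V] [FiniteDimensional F V]
    {q n r c : ℕ} (hq : Fintype.card F = q) (hn : Module.finrank F V = n)
    (x : V ≃ₗ[F] V) (hr : orderOf x = r) (hrp : r.Prime) (hrd : ¬ r ∣ q - 1)
    (hc : Module.finrank F (LinearMap.ker ((x : V →ₗ[F] V) - LinearMap.id)) = c) :
    {W : Submodule F V | Module.finrank F W = 1 ∧
        W.map (x : V →ₗ[F] V) = W}.ncard * (q - 1) = q ^ c - 1 ∧
      ({W : Submodule F V | Module.finrank F W = 1 ∧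
          W.map (x : V →ₗ[F] V) = W}.ncard : ℝ) / (((q ^ n - 1 : ℕ) : ℝ) / ((q - 1 : ℕ) : ℝ))
        = ((q ^ c - 1 : ℕ) : ℝ) / ((q ^ n - 1 : ℕ) : ℝ) ∧
      ((q ^ c - 1 : ℕ) : ℝ) / ((q ^ n - 1 : ℕ) : ℝ) ≤ (q : ℝ) ^ (-((n : ℤ) - (c : ℤ))) := by
  have hlines : {W : Submodule F V | Module.finrank F W = 1 ∧ W.map (x : V →ₗ[F] V) = W} =
      {W : Submodule F V | Module.finrank F W = 1 ∧
        W ≤ LinearMap.ker ((x : V →ₗ[F] V) - LinearMap.id)} := by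
    ext W
    refine and_congr_right fun hW ↦ x.map_eq_self_iff_le_fixed ?_ hW
    rw [hr, hq]
    exact (Nat.Prime.coprime_iff_not_dvd hrp).mpr hrd
  have hcount := Submodule.ncard_lines_le_mul (LinearMap.ker ((x : V →ₗ[F] V) - LinearMap.id))
  rw [Nat.card_eq_fintype_card, hq, hc, ← hlines] at hcount
  have hq1 : 1 < q := hq ▸ Fintype.one_lt_card
  have hcn : c ≤ n := hc ▸ hn ▸ Submodule.finrank_le _
  refine ⟨hcount, ?_, ?_⟩
  · rw [← hcount, div_div_eq_mul_div, Nat.cast_mul]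
  · have hq0 : (0 : ℝ) < q := by positivity
    have hle : (q : ℝ) ^ c ≤ (q : ℝ) ^ n := pow_le_pow_right₀ (by exact_mod_cast hq1.le) hcn
    rw [neg_sub, zpow_sub₀ hq0.ne', zpow_natCast, zpow_natCast,
      Nat.cast_pred (by positivity), Nat.cast_pred (by positivity), Nat.cast_pow, Nat.cast_pow]
    obtain rfl | hn0 := Nat.eq_zero_or_pos n
    · simp
    have hqn : (1 : ℝ) < (q : ℝ) ^ n := one_lt_pow₀ (by exact_mod_cast hq1) hn0.ne'
    rw [div_le_div_iff₀ (by linarith) (by linarith)]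
    linarith
end

section
/- Let F be a finite field with q elements, let V be a finite-dimensional F-vector space, and let x : V ≃ₗ[F] V be a linear automorphism whose order is a prime r not dividing q(q − 1)(q + 1). Then every x-invariant F-subspace U of V of dimension at most 2 is fixed pointwise by x, i.e., x u = u for all u ∈ U. -/
/-- A linear automorphism `y` of a space of dimension at most `2` over a field with `q` elements
is trivial if `y ^ r = 1` for a prime `r` not dividing `q(q - 1)(q + 1)`. -/
theorem LinearEquiv.eq_one_of_pow_prime_eq_one_of_finrank_le_two
    {F W : Type*} [Field F] [Fintype F] [AddCommGroup W] [Module F W] [FiniteDimensional F W]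
    {r : ℕ} (hrp : r.Prime)
    (hrd : ¬ r ∣ Fintype.card F * (Fintype.card F - 1) * (Fintype.card F + 1))
    (hW : Module.finrank F W ≤ 2) (y : W ≃ₗ[F] W) (hy : y ^ r = 1) : y = 1 := by
  classical
  let e : (W ≃ₗ[F] W) ≃* GL (Fin (Module.finrank F W)) F :=
    (LinearMap.GeneralLinearGroup.generalLinearEquiv F W).symm.trans
      (Units.mapEquiv (LinearMap.toMatrixAlgEquiv (Module.finBasis F W)).toMulEquiv)
  rcases (Nat.dvd_prime hrp).1 (orderOf_dvd_of_pow_eq_one hy) with h | h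
  · exact orderOf_eq_one_iff.1 h
  · have hdvd : r ∣ ∏ i : Fin (Module.finrank F W),
        (Fintype.card F ^ Module.finrank F W - Fintype.card F ^ (i : ℕ)) := by
      rw [← Matrix.card_GL_field, ← h, ← MulEquiv.orderOf_eq e y]
      exact orderOf_dvd_natCard _
    refine absurd ?_ hrd
    generalize Module.finrank F W = n at hW hdvd
    generalize Fintype.card F = q at hdvd ⊢
    interval_cases n
    · simp [hrp.ne_one] at hdvd
    · simp only [Fin.prod_univ_one, pow_one, Fin.val_zero, pow_zero] at hdvd
      exact (hdvd.mul_left q).mul_right _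
    · have h1 : q ^ 2 - 1 = (q + 1) * (q - 1) := by simpa using Nat.sq_sub_sq q 1
      have h2 : q ^ 2 - q = q * (q - 1) := by rw [Nat.mul_sub_one, sq]
      simp only [Fin.prod_univ_two, Fin.val_zero, Fin.val_one, pow_zero, pow_one, h1, h2] at hdvd
      rcases (Nat.Prime.dvd_mul hrp).1 hdvd with h | h
      · exact h.trans ⟨q, by ring⟩
      · exact h.mul_right _

/-- Claim "verbose2" in the proof of Proposition 9.2: if `x` is a linear automorphism of
prime order `r` with `r ∤ q(q - 1)(q + 1)` of a finite-dimensional vector space over a field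
with `q` elements, then `x` fixes pointwise every `x`-invariant subspace of dimension at
most `2`. -/
theorem invariant_small_subspace_fixed_of_prime_order
    {F V : Type*} [Field F] [Fintype F] [AddCommGroup V] [Module F V] [FiniteDimensional F V]
    {q r : ℕ} (hq : Fintype.card F = q)
    (x : V ≃ₗ[F] V) (hr : orderOf x = r) (hrp : r.Prime)
    (hrd : ¬ r ∣ q * (q - 1) * (q + 1))
    (U : Submodule F V) (hU : Module.finrank F U ≤ 2)
    (hUx : U.map (x : V →ₗ[F] V) = U) :
    ∀ u ∈ U, x u = u := by
  let y : U ≃ₗ[F] U := (x.submoduleMap U).trans (LinearEquiv.ofEq _ _ hUx)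
  have hpow (n : ℕ) (u : U) : (((y ^ n) u : U) : V) = (x ^ n) u := by
    induction n with
    | zero => rfl
    | succ n ih =>
      rw [pow_succ', pow_succ', LinearEquiv.mul_apply, LinearEquiv.mul_apply, ← ih]
      rfl
  have hy : y ^ r = 1 := by
    ext u
    rw [hpow, ← hr, pow_orderOf_eq_one]
    rfl
  subst hq
  have hy1 := y.eq_one_of_pow_prime_eq_one_of_finrank_le_two hrp hrd hU hy
  intro u hu
  exact congrArg Subtype.val (LinearEquiv.congr_fun hy1 ⟨u, hu⟩)
end

section
/- Let F be a finite field with q elements and let V be an F-vector space of finite dimension n ≥ 5. Every F-linear automorphism x of V induces a permutation π_x of the projective space ℙ(V) of 1-dimensional subspaces of V, sending a line W to its image x(W). Then π_x has a regular cycle: there exists a point P of ℙ(V) whose orbit under the cyclic group generated by π_x has cardinality equal to the order of the permutation π_x (this order equals the order of the image of x in PGL(V)). -/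
open MulAction

open Polynomial in
/-- An endomorphism of a finite-dimensional vector space admits a vector whose annihilating
polynomials annihilate the whole space. -/
theorem LinearMap.exists_forall_aeval_apply_eq_zero {F V : Type*} [Field F] [AddCommGroup V]
    [Module F V] [FiniteDimensional F V] (f : V →ₗ[F] V) :
    ∃ v : V, ∀ p : F[X], aeval f p v = 0 → aeval f p = 0 := by
  obtain ⟨w, hw⟩ := Module.exists_ker_toSpanSingleton_eq_annihilator F[X] (Module.AEval' f)
  obtain ⟨v, rfl⟩ := (Module.AEval'.of f).surjective w
  refine ⟨v, fun p hp => ?_⟩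
  rw [← RingHom.mem_ker, ← Module.AEval.annihilator_eq_ker_aeval (M := V), ← hw,
    LinearMap.mem_ker, LinearMap.toSpanSingleton_apply, ← Module.AEval.of_aeval_smul]
  simpa using hp

/-- The orbit of a point under the powers of an element has as many elements as the order of that
element, provided only the identity power fixes the point. -/
theorem MulAction.ncard_orbit_zpowers_of_forall_smul_eq {G α : Type*} [Group G] [MulAction G α]
    (g : G) (a : α) (h : ∀ k : ℤ, g ^ k • a = a → g ^ k = 1) :
    (orbit (Subgroup.zpowers g) a).ncard = orderOf g := by
  have hinj : Function.Injective fun y : Subgroup.zpowers g => y • a := by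
    intro y z hyz
    obtain ⟨k, hk⟩ := Subgroup.mem_zpowers_iff.1 (z⁻¹ * y).2
    have hfix : (z⁻¹ * y) • a = a := by
      rw [mul_smul, inv_smul_eq_iff]
      exact hyz
    have hone : (z⁻¹ * y : Subgroup.zpowers g) = 1 :=
      Subtype.ext (hk ▸ h k (by rw [hk]; exact hfix))
    exact (inv_mul_eq_one.1 hone).symm
  rw [← Nat.card_zpowers, ← Nat.card_coe_set_eq]
  exact Nat.card_range_of_injective hinj

/-- **Proposition 7.2 / Theorem 1.2** (linear case). Let `F` be a finite field and `V` an
`F`-vector space of dimension `n ≥ 5`. Every linear automorphism `x` of `V` induces a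
permutation of the projective space `ℙ(V)`, and this permutation has a regular cycle: some
point of `ℙ(V)` has orbit under the induced permutation of cardinality equal to the order of
the permutation. -/
theorem projectivization_perm_has_regular_cycle
    {F V : Type*} [Field F] [Fintype F] [AddCommGroup V] [Module F V] [FiniteDimensional F V]
    (hn : 5 ≤ Module.finrank F V)
    (x : V ≃ₗ[F] V) (π : Equiv.Perm (Projectivization F V))
    (hπ : ∀ P : Projectivization F V,
      π P = Projectivization.map (x : V →ₗ[F] V) x.injective P) :
    ∃ P : Projectivization F V,
      (MulAction.orbit (Subgroup.zpowers π) P).ncard = orderOf π := by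
  obtain ⟨v, hv⟩ := LinearMap.exists_forall_aeval_apply_eq_zero (x : V →ₗ[F] V)
  have hv0 : v ≠ 0 := by
    rintro rfl
    have : Nontrivial V := Module.nontrivial_of_finrank_pos (R := F) (by omega)
    exact one_ne_zero (by simpa using hv 1 (by simp) : (1 : V →ₗ[F] V) = 0)
  have hpow : ∀ (k : ℕ) (w : V) (hw : w ≠ 0),
      (π ^ k) (Projectivization.mk F w hw) =
        Projectivization.mk F ((x ^ k) w) ((x ^ k).map_ne_zero_iff.2 hw) := by
    intro k
    induction k with
    | zero => intro w hw; rfl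
    | succ k ih =>
      intro w hw
      rw [pow_succ, Equiv.Perm.mul_apply, hπ, Projectivization.map_mk]
      exact ih (x w) (x.map_ne_zero_iff.2 hw)
  have hnat : ∀ k : ℕ,
      (π ^ k) (Projectivization.mk F v hv0) = Projectivization.mk F v hv0 → π ^ k = 1 := by
    intro k hk
    rw [hpow, Projectivization.mk_eq_mk_iff'] at hk
    obtain ⟨c, hc⟩ := hk
    have hx : ∀ w : V, ((x : V →ₗ[F] V) ^ k) w = (x ^ k) w := fun w => by
      rw [Module.End.pow_apply, LinearEquiv.pow_apply]
      rfl
    have hzero := hv (Polynomial.X ^ k - Polynomial.C c) (by simp [hx, hc])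
    ext P
    induction P using Projectivization.ind with
    | h w hw =>
      rw [hpow, Equiv.Perm.one_apply, Projectivization.mk_eq_mk_iff']
      refine ⟨c, ?_⟩
      have hw' := LinearMap.congr_fun hzero w
      exact (sub_eq_zero.1 (by simpa [hx] using hw')).symm
  refine ⟨Projectivization.mk F v hv0,
    MulAction.ncard_orbit_zpowers_of_forall_smul_eq π _ fun k hk => ?_⟩
  obtain ⟨n, rfl | rfl⟩ := k.eq_nat_or_neg
  · rw [zpow_natCast] at hk ⊢
    exact hnat n hk
  · rw [zpow_neg, zpow_natCast] at hk ⊢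
    rw [inv_eq_one]
    exact hnat n (inv_smul_eq_iff.1 hk).symm
end
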